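/- Let (X,π) be a totally connected (d+1)-partite weighted pure d-dimensional complex with Δ ≥ 1, and let 0 < δ < 1. Assume γ_2 ≤ δ²/(10(1+ln Δ)) and γ_2 ≤ (1−δ)/(Δ+ln Δ). Then for every 3 ≤ k ≤ d+1 and every face τ of co-dimension k: if k ≥ Δ then λ2(P_τ) ≤ 2(1−δ)/(kδ), and if k < Δ then λ2(P_τ) ≤ 2(1−δ)(k+ln k)/((Δ+ln Δ)·kδ). -/

import Mathlib

open Finset in
/-- A pure `d`-dimensional weighted simplicial complex, given by its facets (all of
cardinality `d+1`) together with a full-support probability distribution `pi` on the facets.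
The faces of the complex are all subsets of facets. -/
structure WeightedComplex (V : Type*) [Fintype V] [DecidableEq V] (d : ℕ) where
  facets : Finset (Finset V)
  facets_nonempty : facets.Nonempty
  pure : ∀ τ ∈ facets, τ.card = d + 1
  pi : Finset V → ℝ
  pi_pos : ∀ τ ∈ facets, 0 < pi τ
  pi_eq_zero : ∀ τ, τ ∉ facets → pi τ = 0
  pi_sum_one : ∑ τ ∈ facets, pi τ = 1

namespace WeightedComplex

variable {V : Type*} [Fintype V] [DecidableEq V] {d : ℕ}

/-- `σ` is a face of the complex (a subset of some facet). -/
def IsFace (K : WeightedComplex V d) (σ : Finset V) : Prop :=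
  ∃ η ∈ K.facets, σ ⊆ η

/-- Total `π`-weight of the facets containing `τ`. -/
noncomputable def faceWeight (K : WeightedComplex V d) (τ : Finset V) : ℝ :=
  ∑ η ∈ K.facets.filter (fun η => τ ⊆ η), K.pi η

/-- `Pr_{σ ∼ π_τ}[{x,y} ⊆ σ]`: the weight of the edge `{x,y}` in the 1-skeleton of the
link of `τ`. -/
noncomputable def linkWeight (K : WeightedComplex V d) (τ : Finset V) (x y : V) : ℝ :=
  if x = y ∨ x ∈ τ ∨ y ∈ τ then 0
  else (∑ η ∈ K.facets.filter (fun η => τ ⊆ η ∧ x ∈ η ∧ y ∈ η), K.pi η) / K.faceWeight τ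

/-- The transition probability matrix `P_τ` of the simple random walk on the 1-skeleton of
the link `(X_τ, π_τ)`, padded with zeros outside the `X_τ(0) × X_τ(0)` block. -/
noncomputable def walkMatrix (K : WeightedComplex V d) (τ : Finset V) : Matrix V V ℝ :=
  Matrix.of fun x y => K.linkWeight τ x y / ∑ z, K.linkWeight τ x z

/-- `Pr_{σ ∼ π_τ}[x ∈ σ]`. -/
noncomputable def probMem (K : WeightedComplex V d) (τ : Finset V) (x : V) : ℝ :=
  if x ∈ τ then 0 else K.faceWeight (insert x τ) / K.faceWeight τ

/-- The vertex marginal `π_{τ,0}(x) = Pr_{σ∼π_τ}[x ∈ σ] / codim(τ)`, viewed as a vector on all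
of `V` (zero outside `X_τ(0)`). -/
noncomputable def vertexMarginal (K : WeightedComplex V d) (τ : Finset V) (x : V) : ℝ :=
  ((d + 1 - τ.card : ℕ) : ℝ)⁻¹ * K.probMem τ x

/-- The facets of the link `X_τ`. -/
def linkFacets (K : WeightedComplex V d) (τ : Finset V) : Finset (Finset V) :=
  (K.facets.filter (fun η => τ ⊆ η)).image (fun η => η \ τ)

/-- The facet distribution `π_τ` of the link of `τ`. -/
noncomputable def linkPi (K : WeightedComplex V d) (τ : Finset V) (σ : Finset V) : ℝ :=
  K.pi (σ ∪ τ) / K.faceWeight τ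

/-- The 1-skeleton of the link of every face of co-dimension at least 2 is connected. -/
def TotallyConnected (K : WeightedComplex V d) : Prop :=
  ∀ τ : Finset V, K.IsFace τ → τ.card + 2 ≤ d + 1 →
    ∀ x y : V, x ∉ τ → K.IsFace (insert x τ) → y ∉ τ → K.IsFace (insert y τ) →
      Relation.ReflTransGen (fun a b => 0 < K.linkWeight τ a b) x y

end WeightedComplex

/-- The second largest eigenvalue of a random-walk transition matrix `P`: the largest point of
the real spectrum of `P` lying below the trivial top eigenvalue `1`. -/
noncomputable def lambda2 {n : Type*} [Fintype n] [DecidableEq n] (P : Matrix n n ℝ) : ℝ :=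
  sSup {μ : ℝ | μ < 1 ∧ μ ∈ spectrum ℝ P}

/-- A `(d+1)`-partite pure `d`-dimensional weighted complex: each vertex has a type in
`Fin (d+1)` and every facet contains exactly one vertex of each type. -/
structure PartiteWeightedComplex (V : Type*) [Fintype V] [DecidableEq V] (d : ℕ)
    extends WeightedComplex V d where
  vtype : V → Fin (d + 1)
  partite : ∀ τ ∈ facets, ∀ i : Fin (d + 1), (τ.filter (fun x => vtype x = i)).card = 1

namespace PartiteWeightedComplex

variable {V : Type*} [Fintype V] [DecidableEq V] {d : ℕ}

/-- `ε_{i,j}`: the maximum of `λ₂(P_τ)` over faces `τ` of type `[d] ∖ {i,j}`. -/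
noncomputable def eps (K : PartiteWeightedComplex V d) (i j : Fin (d + 1)) : ℝ :=
  sSup {r : ℝ | ∃ τ : Finset V, K.toWeightedComplex.IsFace τ ∧
    τ.image K.vtype = Finset.univ \ {i, j} ∧
    r = lambda2 (K.toWeightedComplex.walkMatrix τ)}

/-- `Δ(i)`: the number of `j ≠ i` with `ε_{i,j} > 0`. -/
noncomputable def DeltaAt (K : PartiteWeightedComplex V d) (i : Fin (d + 1)) : ℕ :=
  Set.ncard {j : Fin (d + 1) | j ≠ i ∧ 0 < K.eps i j}

/-- `Δ = max_i Δ(i)`. -/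
noncomputable def DeltaMax (K : PartiteWeightedComplex V d) : ℕ :=
  Finset.univ.sup fun i => K.DeltaAt i

end PartiteWeightedComplex

theorem Matrix.mem_spectrum_iff_exists_mulVec {n : Type*} [Fintype n] [DecidableEq n]
    {P : Matrix n n ℝ} {μ : ℝ} : μ ∈ spectrum ℝ P ↔ ∃ v ≠ 0, P.mulVec v = μ • v := by
  rw [← Matrix.spectrum_toLin', ← Module.End.hasEigenvalue_iff_mem_spectrum]
  constructor
  · intro h
    obtain ⟨v, hv⟩ := h.exists_hasEigenvector
    exact ⟨v, hv.2, by simpa using hv.apply_eq_smul⟩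
  · rintro ⟨v, h0, hv⟩
    exact Module.End.hasEigenvalue_of_hasEigenvector
      ⟨Module.End.mem_eigenspace_iff.2 (by simpa using hv), h0⟩

/-- A symmetric operator whose eigenvalues are all at most `c` has quadratic form at most `c`
times the inner product. -/
theorem bilin_apply_le_of_eigenvalue_le {E : Type*} [AddCommGroup E] [Module ℝ E]
    [FiniteDimensional ℝ E] (G : E → E → ℝ) (hsymm : ∀ x y, G x y = G y x)
    (hadd : ∀ x y z, G (x + y) z = G x z + G y z) (hsmul : ∀ (r : ℝ) x y, G (r • x) y = r * G x y)
    (hnonneg : ∀ x, 0 ≤ G x x) (hdef : ∀ x, G x x = 0 → x = 0)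
    (T : E →ₗ[ℝ] E) (hT : ∀ x y, G (T x) y = G x (T y)) {c : ℝ}
    (hc : ∀ x, x ≠ 0 → ∀ μ : ℝ, T x = μ • x → μ ≤ c) (x : E) :
    G (T x) x ≤ c * G x x := by
  let core : InnerProductSpace.Core ℝ E :=
    { inner := G
      conj_inner_symm := fun x y => by simpa using hsymm y x
      re_inner_nonneg := fun x => by simpa using hnonneg x
      add_left := hadd
      smul_left := fun x y r => by simpa using hsmul r x y
      definite := hdef }
  let _ : NormedAddCommGroup E := core.toNormedAddCommGroup
  let _ : InnerProductSpace ℝ E := InnerProductSpace.ofCore core.toCore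
  have hsym : T.IsSymmetric := hT
  let b := hsym.eigenvectorBasis rfl
  have hb : ∀ i, T (b i) = hsym.eigenvalues rfl i • b i := fun i =>
    hsym.apply_eigenvectorBasis rfl i
  have h1 : G (T x) x = ∑ i, hsym.eigenvalues rfl i * (inner ℝ (b i) x) ^ 2 := by
    have := b.sum_inner_mul_inner (T x) x
    change _ = G (T x) x at this
    rw [← this]
    refine Finset.sum_congr rfl fun i _ => ?_
    have : inner ℝ (T x) (b i) = hsym.eigenvalues rfl i * inner ℝ (b i) x := by
      rw [hsym x (b i), hb, inner_smul_right, real_inner_comm]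
    rw [this]; ring
  have h2 : G x x = ∑ i, (inner ℝ (b i) x) ^ 2 := by
    have := b.sum_inner_mul_inner x x
    change _ = G x x at this
    rw [← this]
    refine Finset.sum_congr rfl fun i _ => ?_
    rw [real_inner_comm]; ring
  rw [h1, h2, Finset.mul_sum]
  refine Finset.sum_le_sum fun i _ => ?_
  refine mul_le_mul_of_nonneg_right ?_ (sq_nonneg _)
  exact hc (b i) (b.orthonormal.ne_zero i) _ (hb i)

/-- A bound on the eigenvalues of an operator on `W`, symmetric with respect to the weights `p`,
bounds its quadratic form. -/
theorem weighted_quadratic_le_of_eigenvalue_le {V : Type*} [Fintype V] (p : V → ℝ)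
    (hp : ∀ x, 0 ≤ p x) (W : Submodule ℝ (V → ℝ)) (hW : ∀ f ∈ W, ∀ x, p x = 0 → f x = 0)
    (T : (V → ℝ) →ₗ[ℝ] (V → ℝ)) (hTW : ∀ f ∈ W, T f ∈ W)
    (hT : ∀ f g, ∑ x, p x * (T f x * g x) = ∑ x, p x * (f x * T g x)) {c : ℝ}
    (hc : ∀ f ∈ W, f ≠ 0 → ∀ μ : ℝ, T f = μ • f → μ ≤ c) {f : V → ℝ} (hf : f ∈ W) :
    ∑ x, p x * (T f x * f x) ≤ c * ∑ x, p x * f x ^ 2 := by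
  have := bilin_apply_le_of_eigenvalue_le (E := W)
    (fun f g => ∑ x, p x * ((f : V → ℝ) x * (g : V → ℝ) x))
    (fun f g => Finset.sum_congr rfl fun x _ => by ring)
    (fun f g k => by
      rw [← Finset.sum_add_distrib]
      exact Finset.sum_congr rfl fun x _ => by simp; ring)
    (fun r f g => by
      rw [Finset.mul_sum]
      exact Finset.sum_congr rfl fun x _ => by simp; ring)
    (fun f => Finset.sum_nonneg fun x _ => mul_nonneg (hp x) (mul_self_nonneg _))
    (fun f h => by
      rw [Finset.sum_eq_zero_iff_of_nonneg
        fun x _ => mul_nonneg (hp x) (mul_self_nonneg _)] at h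
      ext x
      rcases mul_eq_zero.1 (h x (Finset.mem_univ x)) with h | h
      · exact hW f f.2 x h
      · simpa using h)
    (T.restrict hTW) (fun f g => hT f g)
    (fun f hf0 μ hμ => hc f f.2 (fun h => hf0 (Subtype.ext h)) μ
      (by simpa using congrArg Subtype.val hμ)) ⟨f, hf⟩
  simpa [pow_two] using this

theorem inv_le_inv_sub_mul_sq {u c c' : ℝ} (hu : 0 < u) (huc : 0 < u - c')
    (h : c' ^ 2 ≤ u * (c' - c)) : u⁻¹ ≤ (u - c')⁻¹ - c * (u - c')⁻¹ ^ 2 := by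
  have : (u - c')⁻¹ - c * (u - c')⁻¹ ^ 2 = (u - c' - c) / (u - c') ^ 2 := by
    field_simp
  rw [this, inv_eq_one_div, div_le_div_iff₀ hu (by positivity)]
  nlinarith

/-- Solution of the recursive inequalities controlling the growth of the spectral bounds: `e`
treats types with a single neighbour, `g` those with several. -/
theorem exists_growth_profile {Δ : ℕ} (hΔ : 1 ≤ Δ) {δ ε : ℝ} (hδ0 : 0 < δ) (hδ1 : δ < 1)
    (hε : 0 < ε) (h1 : ε * (10 * (1 + Real.log Δ)) ≤ δ ^ 2)
    (h2 : ε * (Δ + Real.log Δ) ≤ 1 - δ) :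
    ∃ e g : ℕ → ℝ, e 0 = ε ∧ (∀ n < Δ, 0 ≤ e n ∧ e n ≤ g 1) ∧
      (∀ n, n + 1 < Δ → (n + 1) * e n ≤ (n + 1) * e (n + 1) - e (n + 1) ^ 2) ∧
      (∀ n, 1 ≤ n → n + 1 ≤ Δ → n * g n ≤ n * g (n + 1) - (n + 1) * g (n + 1) ^ 2) ∧
      (∀ n, 1 ≤ n → n ≤ Δ → 0 ≤ g n ∧ g n ≤ 4 / 3 * (ε / δ)) := by
  have hL : 0 ≤ Real.log Δ := Real.log_natCast_nonneg Δ
  set L := Real.log Δ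
  let H : ℕ → ℝ := fun n => (harmonic n : ℝ)
  have hH0 : H 0 = 0 := by simp [H]
  have hHs : ∀ n : ℕ, H (n + 1) = H n + ((n : ℝ) + 1)⁻¹ := fun n => by
    simp [H, harmonic_succ]
  have hHmono : Monotone H := monotone_nat_of_le_succ fun n => by
    rw [hHs]; have : (0 : ℝ) < ((n : ℝ) + 1)⁻¹ := by positivity
    linarith
  have hHΔ : H (Δ - 1) ≤ 1 + L := (hHmono (Nat.sub_le _ _)).trans (harmonic_le_one_add_log Δ)
  have hHnn : ∀ n, 0 ≤ H n := fun n => hH0 ▸ hHmono (Nat.zero_le n)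
  let a : ℕ → ℝ := fun n => ε⁻¹ - 3 / 2 * H n
  let b : ℕ → ℝ := fun n => ε⁻¹ - 3 / 2 * H (Δ - 1) - (1 + δ / 4) * ((n : ℝ) - 1) - 2 * H (n - 1)
  have hlow : 3 / 4 * δ / ε ≤ ε⁻¹ - (1 + δ / 4) * ((Δ : ℝ) - 1) - 7 / 2 * H (Δ - 1) := by
    rw [div_le_iff₀ hε, sub_mul, sub_mul, inv_mul_cancel₀ hε.ne']
    have h3 : H (Δ - 1) * ε ≤ (1 + L) * ε := by gcongr
    nlinarith
  have hbig : 15 / 2 * (1 + L) ≤ 3 / 4 * δ / ε * δ := by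
    rw [show 3 / 4 * δ / ε * δ = 3 / 4 * δ * δ / ε by ring, le_div_iff₀ hε]
    nlinarith
  have hpos : 0 < 3 / 4 * δ / ε := by positivity
  have hb : ∀ n, 1 ≤ n → n ≤ Δ → 3 / 4 * δ / ε ≤ b n := fun n hn hn' => by
    refine hlow.trans ?_
    have h3 : H (n - 1) ≤ H (Δ - 1) := hHmono (Nat.sub_le_sub_right hn' 1)
    have h4 : (n : ℝ) ≤ Δ := by exact_mod_cast hn'
    have h5 : (1 + δ / 4) * ((n : ℝ) - 1) ≤ (1 + δ / 4) * ((Δ : ℝ) - 1) := by gcongr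
    simp only [b]; linarith
  have hab : ∀ n < Δ, b 1 ≤ a n := fun n hn => by
    have : H n ≤ H (Δ - 1) := hHmono (Nat.le_sub_one_of_lt hn)
    simp only [a, b]; simp [hH0]; linarith
  have ha : ∀ n < Δ, 3 / 4 * δ / ε ≤ a n := fun n hn => (hb 1 le_rfl hΔ).trans (hab n hn)
  have hbig' : 15 / 2 ≤ 3 / 4 * δ / ε := by
    nlinarith
  refine ⟨fun n => (a n)⁻¹, fun n => (b n)⁻¹, by simp [a, hH0], fun n hn => ⟨?_, ?_⟩, ?_, ?_, ?_⟩
  · exact inv_nonneg.2 (hpos.le.trans (ha n hn))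
  · exact inv_anti₀ (hpos.trans_le (hb 1 le_rfl hΔ)) (hab n hn)
  · intro n hn
    have hs : a (n + 1) = a n - 3 / 2 * ((n : ℝ) + 1)⁻¹ := by simp only [a, hHs]; ring
    have hn0 : (0 : ℝ) < (n : ℝ) + 1 := by positivity
    have := inv_le_inv_sub_mul_sq (u := a n) (c := ((n : ℝ) + 1)⁻¹)
      (c' := 3 / 2 * ((n : ℝ) + 1)⁻¹) (hpos.trans_le (ha n (by omega)))
      (by rw [← hs]; exact hpos.trans_le (ha _ hn)) (by
        have h3 : ((n : ℝ) + 1)⁻¹ ≤ 1 := inv_le_one_of_one_le₀ (by linarith)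
        have h4 : 0 < ((n : ℝ) + 1)⁻¹ := by positivity
        have h5 := hbig'.trans (ha n (by omega))
        nlinarith)
    rw [← hs] at this
    have h3 := mul_le_mul_of_nonneg_left this hn0.le
    rw [mul_sub, ← mul_assoc, mul_inv_cancel₀ hn0.ne', one_mul] at h3
    simpa using h3
  · intro n hn hn'
    have hn0 : (0 : ℝ) < n := by exact_mod_cast hn
    obtain ⟨m, rfl⟩ : ∃ m, n = m + 1 := ⟨n - 1, by omega⟩
    have hs : b (m + 1 + 1) = b (m + 1) - (1 + δ / 4 + 2 * ((m : ℝ) + 1)⁻¹) := by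
      simp only [b, Nat.add_sub_cancel, hHs]; push_cast; ring
    have hL2 : 1 / 2 ≤ L := by
      have : (2 : ℝ) ≤ Δ := by exact_mod_cast (by omega : 2 ≤ Δ)
      have := Real.log_le_log (by norm_num) this
      have := Real.log_two_gt_d9
      simp only [L]; linarith
    have := inv_le_inv_sub_mul_sq (u := b (m + 1)) (c := 1 + ((m : ℝ) + 1)⁻¹)
      (c' := 1 + δ / 4 + 2 * ((m : ℝ) + 1)⁻¹) (hpos.trans_le (hb (m + 1) hn (by omega)))
      (by rw [← hs]; exact hpos.trans_le (hb _ (by omega) hn')) (by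
        have h3 : ((m : ℝ) + 1)⁻¹ ≤ 1 := inv_le_one_of_one_le₀ (by push_cast at hn0; linarith)
        have h4 : 0 < ((m : ℝ) + 1)⁻¹ := by push_cast at hn0; positivity
        set r := ((m : ℝ) + 1)⁻¹
        have h5 := hb (m + 1) hn (by omega)
        have h6 : 45 / 4 ≤ b (m + 1) * δ := by
          have : 3 / 4 * δ / ε * δ ≤ b (m + 1) * δ := by gcongr
          linarith
        have h7 : 45 / 4 ≤ b (m + 1) := by nlinarith
        have h8 : 45 / 4 * r ≤ b (m + 1) * r := by gcongr
        nlinarith)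
    rw [← hs] at this
    have h3 := mul_le_mul_of_nonneg_left this hn0.le
    push_cast at h3 hn0 ⊢
    rw [mul_sub, ← mul_assoc, mul_add, mul_inv_cancel₀ hn0.ne', mul_one] at h3
    exact h3
  · intro n hn hn'
    refine ⟨inv_nonneg.2 (hpos.le.trans (hb n hn hn')), ?_⟩
    refine (inv_anti₀ hpos (hb n hn hn')).trans (le_of_eq ?_)
    field_simp

section Profile

variable {ι : Type*} [DecidableEq ι]

/-- The spectral bound attached to the type `i` in the set of types `S`, where `N` is the
neighbourhood map of the graph of correlated types. -/
noncomputable def typeBound (N : ι → Finset ι) (e g : ℕ → ℝ) (S : Finset ι) (i : ι) : ℝ :=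
  if (N i ∩ S).card = 0 then 0
  else if (N i ∩ S).card = 1 then e (∑ j ∈ N i ∩ S, ((N j ∩ S).card - 1))
  else (N i ∩ S).card * g (N i ∩ S).card

/-- `i` and `j` are correlated with each other and with no other type in `S`. -/
def IsolatedPair (N : ι → Finset ι) (S : Finset ι) (i j : ι) : Prop :=
  N i ∩ S = {j} ∧ N j ∩ S = {i}

variable {N : ι → Finset ι} {e g : ℕ → ℝ} {S : Finset ι} {i j : ι}

theorem typeBound_of_inter_eq_empty (h : N i ∩ S = ∅) : typeBound N e g S i = 0 := by
  simp [typeBound, h]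

theorem typeBound_of_inter_eq_singleton (h : N i ∩ S = {j}) :
    typeBound N e g S i = e ((N j ∩ S).card - 1) := by
  simp [typeBound, h]

theorem typeBound_of_two_le (h : 2 ≤ (N i ∩ S).card) :
    typeBound N e g S i = (N i ∩ S).card * g (N i ∩ S).card := by
  rw [typeBound, if_neg (by omega), if_neg (by omega)]

theorem typeBound_congr {T : Finset ι} (h : N i ∩ S = N i ∩ T)
    (h' : ∀ j ∈ N i ∩ S, N j ∩ S = N j ∩ T) : typeBound N e g S i = typeBound N e g T i := by
  have : ∑ j ∈ N i ∩ S, ((N j ∩ S).card - 1) = ∑ j ∈ N i ∩ T, ((N j ∩ T).card - 1) := by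
    rw [← h]; exact Finset.sum_congr rfl fun j hj => by rw [h' j hj]
  rw [typeBound, typeBound, this, h]

theorem inter_erase_of_notMem {A B : Finset ι} {b : ι} (h : b ∉ A) : A ∩ B.erase b = A ∩ B := by
  grind

variable {Δ : ℕ}

theorem typeBound_nonneg_le {G : ℝ} (hdeg : ∀ i, (N i).card ≤ Δ)
    (he : ∀ n < Δ, 0 ≤ e n ∧ e n ≤ g 1)
    (hg : ∀ n, 1 ≤ n → n ≤ Δ → 0 ≤ g n ∧ g n ≤ G) (S : Finset ι) (i : ι) :
    0 ≤ typeBound N e g S i ∧ typeBound N e g S i ≤ (N i ∩ S).card * G := by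
  have hD : ∀ j, (N j ∩ S).card ≤ Δ := fun j =>
    (Finset.card_le_card Finset.inter_subset_left).trans (hdeg j)
  rcases Nat.lt_or_ge (N i ∩ S).card 2 with h | h
  · interval_cases hc : (N i ∩ S).card
    · simp [typeBound_of_inter_eq_empty (Finset.card_eq_zero.1 hc)]
    · obtain ⟨j, hj⟩ := Finset.card_eq_one.1 hc
      have hΔ : 1 ≤ Δ := hc ▸ hD i
      rw [typeBound_of_inter_eq_singleton hj]
      have := he ((N j ∩ S).card - 1) (by have := hD j; omega)
      exact ⟨this.1, by simpa using this.2.trans (hg 1 le_rfl hΔ).2⟩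
  · rw [typeBound_of_two_le h]
    have := hg _ (by omega) (hD i)
    exact ⟨mul_nonneg (Nat.cast_nonneg _) this.1, by gcongr; exact this.2⟩

theorem sum_typeBound_erase_le (hsymm : ∀ i j, j ∈ N i → i ∈ N j) (hirr : ∀ i, i ∉ N i)
    (hdeg : ∀ i, (N i).card ≤ Δ) (he : ∀ n < Δ, 0 ≤ e n ∧ e n ≤ g 1)
    (he' : ∀ n, n + 1 < Δ → (n + 1) * e n ≤ (n + 1) * e (n + 1) - e (n + 1) ^ 2)
    (hg' : ∀ n, 1 ≤ n → n + 1 ≤ Δ → n * g n ≤ n * g (n + 1) - (n + 1) * g (n + 1) ^ 2)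
    (hi : i ∈ S) (hiso : ∀ j ∈ S, ¬ IsolatedPair N S i j) :
    ∑ b ∈ S.erase i, typeBound N e g (S.erase b) i ≤
      ((S.card : ℝ) - 2) * typeBound N e g S i - typeBound N e g S i ^ 2 := by
  have hD : ∀ j, (N j ∩ S).card ≤ Δ := fun j =>
    (Finset.card_le_card Finset.inter_subset_left).trans (hdeg j)
  have hsub : N i ∩ S ⊆ S.erase i := fun b hb => by
    rw [Finset.mem_inter] at hb
    exact Finset.mem_erase.2 ⟨fun h => hirr i (h ▸ hb.1), hb.2⟩
  have hcard : ((S.erase i).card : ℝ) = S.card - 1 := by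
    rw [Finset.card_erase_of_mem hi, Nat.cast_pred (Finset.card_pos.2 ⟨i, hi⟩)]
  rcases Nat.lt_or_ge (N i ∩ S).card 2 with h | h
  · interval_cases hc : (N i ∩ S).card
    · have h0 := Finset.card_eq_zero.1 hc
      rw [typeBound_of_inter_eq_empty h0, Finset.sum_eq_zero]
      · simp
      · intro b _
        refine typeBound_of_inter_eq_empty (Finset.subset_empty.1 ?_)
        exact h0 ▸ Finset.inter_subset_inter_left (Finset.erase_subset _ _)
    · obtain ⟨j, hj⟩ := Finset.card_eq_one.1 hc
      have hjm : j ∈ N i ∩ S := hj ▸ Finset.mem_singleton_self j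
      have hjN := (Finset.mem_inter.1 hjm).1
      have hjS := (Finset.mem_inter.1 hjm).2
      have hij : i ∈ N j ∩ S := Finset.mem_inter.2 ⟨hsymm i j hjN, hi⟩
      set M := (N j ∩ S).erase i with hM
      obtain ⟨n, hn⟩ : ∃ n, M.card = n + 1 := by
        refine Nat.exists_eq_succ_of_ne_zero fun h0 => hiso j hjS ⟨hj, ?_⟩
        have h0 := Finset.card_eq_zero.1 h0
        rw [← Finset.insert_erase hij, ← hM, h0]; simp
      have hNj : (N j ∩ S).card = n + 2 := by
        rw [← Finset.card_erase_add_one hij, ← hM, hn]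
      have hval : typeBound N e g S i = e (n + 1) := by
        rw [typeBound_of_inter_eq_singleton hj, hNj]; rfl
      have hterm : ∀ b ∈ (S.erase i), typeBound N e g (S.erase b) i =
          e (n + 1) - (if b = j then e (n + 1) else 0) -
            (if b ∈ M then e (n + 1) - e n else 0) := by
        intro b hb
        have hbi : b ≠ i := Finset.ne_of_mem_erase hb
        have hjM : j ∉ M := fun h => hirr j (Finset.mem_inter.1 (Finset.mem_of_mem_erase h)).1
        by_cases hbj : b = j
        · subst hbj
          rw [typeBound_of_inter_eq_empty, if_pos rfl, if_neg hjM]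
          · ring
          · rw [Finset.inter_erase, hj]; simp
        · have hj' : N i ∩ S.erase b = {j} := by
            rw [Finset.inter_erase, hj, Finset.erase_eq_of_notMem (by simpa using hbj)]
          rw [typeBound_of_inter_eq_singleton hj', if_neg hbj, Finset.inter_erase]
          by_cases hbM : b ∈ M
          · rw [if_pos hbM, Finset.card_erase_of_mem (Finset.mem_of_mem_erase hbM), hNj]
            simp
          · rw [if_neg hbM, Finset.erase_eq_of_notMem
              (fun h => hbM (Finset.mem_erase.2 ⟨hbi, h⟩)), hNj]
            simp
      have hMS : M ⊆ S.erase i := Finset.erase_subset_erase _ Finset.inter_subset_right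
      rw [Finset.sum_congr rfl hterm, Finset.sum_sub_distrib, Finset.sum_sub_distrib,
        Finset.sum_ite_eq', if_pos (hsub hjm), Finset.sum_const, nsmul_eq_mul, hcard,
        Finset.sum_ite_mem, Finset.inter_eq_right.2 hMS, Finset.sum_const, nsmul_eq_mul, hn, hval]
      have := he' n (by have := hD j; omega)
      push_cast
      linarith
  · obtain ⟨n, hn⟩ : ∃ n, (N i ∩ S).card = n + 1 := ⟨(N i ∩ S).card - 1, by omega⟩
    have hval : typeBound N e g S i = (n + 1) * g (n + 1) := by
      rw [typeBound_of_two_le h, hn]; push_cast; ring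
    have hterm : ∀ b ∈ (S.erase i), typeBound N e g (S.erase b) i ≤
          (n + 1) * g (n + 1) - (if b ∈ N i ∩ S then (n + 1) * g (n + 1) - n * g n else 0) := by
      intro b hb
      by_cases hbN : b ∈ N i ∩ S
      · rw [if_pos hbN, sub_sub_cancel]
        have hc : (N i ∩ S.erase b).card = n := by
          rw [Finset.inter_erase, Finset.card_erase_of_mem hbN, hn]; rfl
        rcases Nat.lt_or_ge n 2 with hn2 | hn2
        · obtain rfl : n = 1 := by omega
          obtain ⟨j, hj⟩ := Finset.card_eq_one.1 hc
          rw [typeBound_of_inter_eq_singleton hj]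
          have h1 : (N j ∩ S.erase b).card ≤ Δ :=
            (Finset.card_le_card Finset.inter_subset_left).trans (hdeg j)
          have h2 := hD i
          simpa using (he ((N j ∩ S.erase b).card - 1) (by omega)).2
        · rw [typeBound_of_two_le (by omega), hc]
      · rw [if_neg hbN, sub_zero, ← hval, typeBound_of_two_le h,
          typeBound_of_two_le (by rw [Finset.inter_erase, Finset.erase_eq_of_notMem hbN]; exact h),
          Finset.inter_erase, Finset.erase_eq_of_notMem hbN]
    refine (Finset.sum_le_sum hterm).trans ?_
    rw [Finset.sum_sub_distrib, Finset.sum_const, nsmul_eq_mul, hcard, Finset.sum_ite_mem,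
      Finset.inter_eq_right.2 hsub, Finset.sum_const, nsmul_eq_mul, hn, hval]
    have := mul_le_mul_of_nonneg_left (hg' n (by omega) (by have := hD i; omega))
      (by positivity : (0 : ℝ) ≤ (n : ℝ) + 1)
    push_cast
    linarith

end Profile

namespace WeightedComplex

variable {V : Type*} [Fintype V] [DecidableEq V] {d : ℕ} (K : WeightedComplex V d)

theorem IsFace.mono {K : WeightedComplex V d} {σ τ : Finset V} (h : K.IsFace τ) (hs : σ ⊆ τ) :
    K.IsFace σ :=
  let ⟨η, hη, hτ⟩ := h
  ⟨η, hη, hs.trans hτ⟩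

theorem pi_nonneg (η : Finset V) : 0 ≤ K.pi η := by
  by_cases h : η ∈ K.facets
  · exact (K.pi_pos η h).le
  · exact (K.pi_eq_zero η h).ge

theorem faceWeight_nonneg (σ : Finset V) : 0 ≤ K.faceWeight σ :=
  Finset.sum_nonneg fun η _ => K.pi_nonneg η

variable {K} in
theorem IsFace.faceWeight_pos {σ : Finset V} (h : K.IsFace σ) : 0 < K.faceWeight σ := by
  obtain ⟨η, hη, hσ⟩ := h
  exact Finset.sum_pos (fun η h => K.pi_pos η (Finset.mem_filter.1 h).1)
    ⟨η, Finset.mem_filter.2 ⟨hη, hσ⟩⟩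

theorem faceWeight_eq_zero {σ : Finset V} (h : ¬ K.IsFace σ) : K.faceWeight σ = 0 := by
  refine Finset.sum_eq_zero fun η hη => absurd ?_ h
  exact ⟨η, (Finset.mem_filter.1 hη).1, (Finset.mem_filter.1 hη).2⟩

/-- The weight of the facets through `τ` and a vertex `x` of its link. -/
noncomputable def vertexWeight (τ : Finset V) (x : V) : ℝ :=
  if x ∈ τ then 0 else K.faceWeight (insert x τ)

/-- The weight of the facets through `τ` and an edge `x, y` of its link. -/
noncomputable def edgeWeight (τ : Finset V) (x y : V) : ℝ :=
  if x ∈ τ then 0 else K.vertexWeight (insert x τ) y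

variable {τ : Finset V} {x y z : V}

theorem vertexWeight_of_mem (hx : x ∈ τ) : K.vertexWeight τ x = 0 := if_pos hx

theorem vertexWeight_of_notMem (hx : x ∉ τ) : K.vertexWeight τ x = K.faceWeight (insert x τ) :=
  if_neg hx

theorem vertexWeight_nonneg (τ : Finset V) (x : V) : 0 ≤ K.vertexWeight τ x := by
  unfold vertexWeight; split_ifs
  exacts [le_rfl, K.faceWeight_nonneg _]

variable {K} in
theorem isFace_insert_of_vertexWeight_ne_zero (h : K.vertexWeight τ x ≠ 0) :
    x ∉ τ ∧ K.IsFace (insert x τ) := by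
  unfold vertexWeight at h; split_ifs at h with hx
  · exact absurd rfl h
  · exact ⟨hx, by_contra fun h' => h (K.faceWeight_eq_zero h')⟩

theorem vertexWeight_pos (hx : x ∉ τ) (h : K.IsFace (insert x τ)) : 0 < K.vertexWeight τ x := by
  rw [K.vertexWeight_of_notMem hx]; exact h.faceWeight_pos

theorem edgeWeight_of_notMem (hx : x ∉ τ) :
    K.edgeWeight τ x y = K.vertexWeight (insert x τ) y := if_neg hx

theorem edgeWeight_nonneg (τ : Finset V) (x y : V) : 0 ≤ K.edgeWeight τ x y := by
  unfold edgeWeight; split_ifs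
  exacts [le_rfl, K.vertexWeight_nonneg _ _]

theorem edgeWeight_eq_ite (τ : Finset V) (x y : V) : K.edgeWeight τ x y =
    if x = y ∨ x ∈ τ ∨ y ∈ τ then 0 else K.faceWeight (insert x (insert y τ)) := by
  unfold edgeWeight vertexWeight
  rw [Finset.insert_comm]
  grind

theorem edgeWeight_comm (τ : Finset V) (x y : V) : K.edgeWeight τ x y = K.edgeWeight τ y x := by
  rw [edgeWeight_eq_ite, edgeWeight_eq_ite, Finset.insert_comm]
  grind

variable {K} in
theorem of_edgeWeight_ne_zero (h : K.edgeWeight τ x y ≠ 0) :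
    x ≠ y ∧ x ∉ τ ∧ y ∉ τ ∧ K.IsFace (insert x (insert y τ)) := by
  rw [edgeWeight_eq_ite] at h
  split_ifs at h with hx
  · exact absurd rfl h
  · push Not at hx
    exact ⟨hx.1, hx.2.1, hx.2.2, by_contra fun h' => h (K.faceWeight_eq_zero h')⟩

theorem edgeWeight_pos (hxy : x ≠ y) (hx : x ∉ τ) (hy : y ∉ τ)
    (h : K.IsFace (insert x (insert y τ))) : 0 < K.edgeWeight τ x y := by
  rw [edgeWeight_eq_ite, if_neg (by tauto)]; exact h.faceWeight_pos

theorem edgeWeight_eq_zero_of_vertexWeight (h : K.vertexWeight τ x = 0) :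
    K.edgeWeight τ x y = 0 := by
  by_contra h'
  obtain ⟨-, hx, -, hf⟩ := of_edgeWeight_ne_zero h'
  exact (K.vertexWeight_pos hx (hf.mono (by grind))).ne' h

theorem edgeWeight_eq_zero_of_vertexWeight_right (h : K.vertexWeight τ y = 0) :
    K.edgeWeight τ x y = 0 := by
  rw [edgeWeight_comm, K.edgeWeight_eq_zero_of_vertexWeight h]

theorem edgeWeight_insert (hz : z ∉ τ) (hxy : x ≠ y) (hx : x ∉ τ) (hy : y ∉ τ) :
    K.edgeWeight (insert z τ) x y = K.vertexWeight (insert x (insert y τ)) z := by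
  rw [edgeWeight_eq_ite, vertexWeight]
  have : insert x (insert y (insert z τ)) = insert z (insert x (insert y τ)) := by
    ext; simp; tauto
  rw [this]
  grind

theorem linkWeight_eq (τ : Finset V) (x y : V) :
    K.linkWeight τ x y = K.edgeWeight τ x y / K.faceWeight τ := by
  rw [edgeWeight_eq_ite, linkWeight]
  split_ifs
  · simp
  · congr 1
    rw [faceWeight]
    congr 1
    ext η
    simp only [Finset.mem_filter, Finset.insert_subset_iff]
    tauto

end WeightedComplex

namespace PartiteWeightedComplex

open WeightedComplex

variable {V : Type*} [Fintype V] [DecidableEq V] {d : ℕ} (K : PartiteWeightedComplex V d)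

/-- The types not used by `τ`, that is, the types of the vertices of its link. -/
def freeTypes (τ : Finset V) : Finset (Fin (d + 1)) := Finset.univ \ τ.image K.vtype

variable {τ : Finset V} {x y z : V}

theorem exists_mem_vtype {η : Finset V} (hη : η ∈ K.facets) (i : Fin (d + 1)) :
    ∃ x ∈ η, K.vtype x = i := by
  obtain ⟨x, hx⟩ := Finset.card_eq_one.1 (K.partite η hη i)
  have : x ∈ η.filter (fun x => K.vtype x = i) := hx ▸ Finset.mem_singleton_self x
  exact ⟨x, by simpa using this⟩

variable {K} in
theorem _root_.WeightedComplex.IsFace.eq_of_vtype_eq (hf : K.IsFace τ) (hx : x ∈ τ) (hy : y ∈ τ)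
    (h : K.vtype x = K.vtype y) : x = y := by
  obtain ⟨η, hη, hτ⟩ := hf
  exact Finset.card_le_one.1 (K.partite η hη (K.vtype y)).le x (by simp [hτ hx, h]) y
    (by simp [hτ hy])

variable {K} in
theorem _root_.WeightedComplex.IsFace.card_freeTypes (hf : K.IsFace τ) :
    (K.freeTypes τ).card + τ.card = d + 1 := by
  have h : (τ.image K.vtype).card = τ.card :=
    Finset.card_image_of_injOn fun x hx y hy h => hf.eq_of_vtype_eq hx hy h
  rw [freeTypes, ← h, Finset.card_sdiff_add_card_eq_card (Finset.subset_univ _), Finset.card_univ,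
    Fintype.card_fin]

theorem freeTypes_insert (τ : Finset V) (x : V) :
    K.freeTypes (insert x τ) = (K.freeTypes τ).erase (K.vtype x) := by
  ext i; simp [freeTypes]

variable {K} in
theorem notMem_of_vtype_mem_freeTypes (h : K.vtype x ∈ K.freeTypes τ) : x ∉ τ := fun hx => by
  simp only [freeTypes, Finset.mem_sdiff, Finset.mem_univ, true_and] at h
  exact h (Finset.mem_image_of_mem _ hx)

variable {K} in
theorem vtype_mem_freeTypes (hx : x ∉ τ) (hf : K.IsFace (insert x τ)) :
    K.vtype x ∈ K.freeTypes τ := by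
  simp only [freeTypes, Finset.mem_sdiff, Finset.mem_univ, true_and, Finset.mem_image, not_exists,
    not_and]
  intro y hy h
  exact hx (hf.eq_of_vtype_eq (Finset.mem_insert_of_mem hy) (Finset.mem_insert_self _ _) h ▸ hy)

variable {K} in
theorem vtype_mem_of_vertexWeight_ne_zero (h : K.vertexWeight τ x ≠ 0) :
    K.vtype x ∈ K.freeTypes τ :=
  let ⟨hx, hf⟩ := isFace_insert_of_vertexWeight_ne_zero h
  vtype_mem_freeTypes hx hf

variable {K} in
theorem vtype_mem_of_edgeWeight_ne_zero (h : K.edgeWeight τ x y ≠ 0) :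
    K.vtype x ∈ K.freeTypes τ ∧ K.vtype y ∈ K.freeTypes τ ∧ K.vtype x ≠ K.vtype y := by
  obtain ⟨hxy, hx, hy, hf⟩ := of_edgeWeight_ne_zero h
  refine ⟨vtype_mem_freeTypes hx (hf.mono (by grind)), vtype_mem_freeTypes hy
    (hf.mono (by grind)), fun h => hxy (hf.eq_of_vtype_eq ?_ ?_ h)⟩ <;> simp

theorem sum_faceWeight_insert (σ : Finset V) (b : Fin (d + 1)) :
    ∑ x with K.vtype x = b, K.faceWeight (insert x σ) = K.faceWeight σ := by
  simp only [faceWeight, Finset.sum_filter]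
  rw [← Finset.sum_filter, Finset.sum_comm]
  refine Finset.sum_congr rfl fun η hη => ?_
  split_ifs with h
  · simp only [Finset.insert_subset_iff, h, and_true]
    rw [← Finset.sum_filter, Finset.sum_const]
    have : (Finset.univ.filter fun x => K.vtype x = b).filter (fun x => x ∈ η) =
        η.filter fun x => K.vtype x = b := by
      ext; simp [and_comm]
    rw [this, K.partite η hη b, one_smul]
  · refine Finset.sum_eq_zero fun x _ => if_neg fun h' => h ?_
    exact (Finset.subset_insert _ _).trans h'

theorem sum_vertexWeight (τ : Finset V) (b : Fin (d + 1)) :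
    ∑ x with K.vtype x = b, K.vertexWeight τ x =
      if b ∈ K.freeTypes τ then K.faceWeight τ else 0 := by
  split_ifs with hb
  · rw [← K.sum_faceWeight_insert τ b]
    refine Finset.sum_congr rfl fun x hx => K.vertexWeight_of_notMem ?_
    exact notMem_of_vtype_mem_freeTypes ((Finset.mem_filter.1 hx).2 ▸ hb)
  · refine Finset.sum_eq_zero fun x hx => by_contra fun h => hb ?_
    exact (Finset.mem_filter.1 hx).2 ▸ vtype_mem_of_vertexWeight_ne_zero h

theorem sum_edgeWeight (τ : Finset V) (x : V) (b : Fin (d + 1)) :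
    ∑ y with K.vtype y = b, K.edgeWeight τ x y =
      if b ∈ (K.freeTypes τ).erase (K.vtype x) then K.vertexWeight τ x else 0 := by
  by_cases hx : x ∈ τ
  · simp [edgeWeight, vertexWeight, hx]
  · simp only [K.edgeWeight_of_notMem hx]
    rw [sum_vertexWeight, freeTypes_insert, K.vertexWeight_of_notMem hx]

/-- Sums over all vertices split according to the type. -/
theorem sum_eq_sum_vtype (F : V → ℝ) : ∑ x, F x = ∑ b, ∑ x with K.vtype x = b, F x :=
  (Finset.sum_fiberwise _ _ _).symm

theorem sum_edgeWeight_mul (τ : Finset V) (x : V) (m : Fin (d + 1) → ℝ) :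
    ∑ y, K.edgeWeight τ x y * m (K.vtype y) =
      K.vertexWeight τ x * ∑ b ∈ (K.freeTypes τ).erase (K.vtype x), m b := by
  rw [K.sum_eq_sum_vtype, Finset.mul_sum, ← Finset.sum_subset (Finset.subset_univ _)]
  · refine Finset.sum_congr rfl fun b hb => ?_
    have := K.sum_edgeWeight τ x b
    rw [if_pos hb] at this
    rw [← this, Finset.sum_mul]
    exact Finset.sum_congr rfl fun y hy => by rw [(Finset.mem_filter.1 hy).2]
  · intro b _ hb
    have := K.sum_edgeWeight τ x b
    rw [if_neg hb] at this
    rw [← zero_mul (m b), ← this, Finset.sum_mul]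
    exact Finset.sum_congr rfl fun y hy => by rw [(Finset.mem_filter.1 hy).2]

/-- Conditioning on a vertex `z` of type `b`. -/
theorem sum_edgeWeight_insert (τ : Finset V) (x y : V) (b : Fin (d + 1)) :
    ∑ z with K.vtype z = b, (if z ∈ τ then 0 else K.edgeWeight (insert z τ) x y) =
      if b ∈ ((K.freeTypes τ).erase (K.vtype x)).erase (K.vtype y) then K.edgeWeight τ x y
      else 0 := by
  by_cases h : x = y ∨ x ∈ τ ∨ y ∈ τ
  · have h0 : ∀ σ, τ ⊆ σ → K.edgeWeight σ x y = 0 := fun σ hσ => by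
      rw [K.edgeWeight_eq_ite, if_pos (by grind)]
    simp [h0 τ subset_rfl, h0 _ (Finset.subset_insert _ τ)]
  · push Not at h
    obtain ⟨hxy, hx, hy⟩ := h
    have hsum := K.sum_vertexWeight (insert x (insert y τ)) b
    rw [freeTypes_insert, freeTypes_insert, Finset.erase_right_comm] at hsum
    have hval : K.edgeWeight τ x y = K.faceWeight (insert x (insert y τ)) := by
      rw [K.edgeWeight_eq_ite, if_neg (by tauto)]
    rw [hval, ← hsum]
    refine Finset.sum_congr rfl fun z _ => ?_
    split_ifs with hz
    · rw [K.vertexWeight_of_mem (by simp [hz])]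
    · rw [K.edgeWeight_insert hz hxy hx hy]

theorem sum_edgeWeight_right (τ : Finset V) (x : V) :
    ∑ y, K.edgeWeight τ x y = ((K.freeTypes τ).card - 1) * K.vertexWeight τ x := by
  have := K.sum_edgeWeight_mul τ x fun _ => 1
  simp only [mul_one, Finset.sum_const, nsmul_eq_mul] at this
  rw [this, mul_comm]
  by_cases h : K.vertexWeight τ x = 0
  · simp [h]
  · have hx := vtype_mem_of_vertexWeight_ne_zero h
    rw [Finset.card_erase_of_mem hx, Nat.cast_pred (Finset.card_pos.2 ⟨_, hx⟩)]

theorem walkMatrix_apply (hτ : K.IsFace τ) (x y : V) : K.walkMatrix τ x y =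
    K.edgeWeight τ x y / (((K.freeTypes τ).card - 1) * K.vertexWeight τ x) := by
  simp only [walkMatrix, Matrix.of_apply, linkWeight_eq]
  rw [← Finset.sum_div, K.sum_edgeWeight_right, div_div_div_cancel_right₀ hτ.faceWeight_pos.ne']

/-- The (unnormalized) walk operator of the link of `τ`: it sends `f` to the sum over all types
of the conditional expectations of `f` given a vertex. -/
noncomputable def linkOp (τ : Finset V) : (V → ℝ) →ₗ[ℝ] (V → ℝ) where
  toFun f x := (∑ y, K.edgeWeight τ x y * f y) / K.vertexWeight τ x
  map_add' f g := by
    ext x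
    simp only [Pi.add_apply, mul_add, Finset.sum_add_distrib, add_div]
  map_smul' r f := by
    ext x
    simp only [Pi.smul_apply, smul_eq_mul, RingHom.id_apply, ← mul_div_assoc, Finset.mul_sum]
    congr 1
    exact Finset.sum_congr rfl fun y _ => by ring

theorem linkOp_apply (τ : Finset V) (f : V → ℝ) (x : V) :
    K.linkOp τ f x = (∑ y, K.edgeWeight τ x y * f y) / K.vertexWeight τ x := rfl

theorem vertexWeight_mul_linkOp (τ : Finset V) (f : V → ℝ) (x : V) :
    K.vertexWeight τ x * K.linkOp τ f x = ∑ y, K.edgeWeight τ x y * f y := by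
  by_cases h : K.vertexWeight τ x = 0
  · simp [h, K.edgeWeight_eq_zero_of_vertexWeight h]
  · rw [linkOp_apply, mul_div_cancel₀ _ h]

/-- The quadratic form of the link of `τ`. -/
noncomputable def edgeForm (τ : Finset V) (f : V → ℝ) : ℝ :=
  ∑ x, ∑ y, K.edgeWeight τ x y * (f x * f y)

theorem edgeForm_eq (τ : Finset V) (f : V → ℝ) :
    K.edgeForm τ f = ∑ x, K.vertexWeight τ x * (K.linkOp τ f x * f x) := by
  refine Finset.sum_congr rfl fun x _ => ?_
  rw [← mul_assoc, vertexWeight_mul_linkOp, Finset.sum_mul]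
  exact Finset.sum_congr rfl fun y _ => by ring

/-- `f` has mean zero on every part of the link of `τ`. -/
def MeanZero (τ : Finset V) (f : V → ℝ) : Prop :=
  ∀ i, ∑ x with K.vtype x = i, K.vertexWeight τ x * f x = 0

/-- On functions with mean zero on every part, the quadratic form of the link of `τ` is bounded
by the weighted variances with factors `h`. -/
def VarianceBound (τ : Finset V) (h : Fin (d + 1) → ℝ) : Prop :=
  ∀ f : V → ℝ, K.MeanZero τ f →
    K.edgeForm τ f ≤ ∑ x, K.vertexWeight τ x * (h (K.vtype x) * f x ^ 2)

/-- The mean of `f` on the part `a` of the link of `τ`. -/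
noncomputable def typeMean (τ : Finset V) (f : V → ℝ) (a : Fin (d + 1)) : ℝ :=
  (∑ x with K.vtype x = a, K.vertexWeight τ x * f x) / K.faceWeight τ

theorem sum_vtype_eq_zero {a : Fin (d + 1)} (ha : a ∉ K.freeTypes τ) (f : V → ℝ) :
    ∑ x with K.vtype x = a, K.vertexWeight τ x * f x = 0 := by
  refine Finset.sum_eq_zero fun x hx => ?_
  have : K.vertexWeight τ x = 0 := by_contra fun h => ha <|
    (Finset.mem_filter.1 hx).2 ▸ vtype_mem_of_vertexWeight_ne_zero h
  rw [this, zero_mul]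

theorem sum_vertexWeight_mul_mul (hτ : K.IsFace τ) (f : V → ℝ) (c : Fin (d + 1) → ℝ) :
    ∑ x, K.vertexWeight τ x * (f x * c (K.vtype x)) =
      K.faceWeight τ * ∑ a ∈ K.freeTypes τ, K.typeMean τ f a * c a := by
  have key : ∀ a, ∑ x with K.vtype x = a, K.vertexWeight τ x * (f x * c (K.vtype x)) =
      (∑ x with K.vtype x = a, K.vertexWeight τ x * f x) * c a := fun a => by
    rw [Finset.sum_mul]
    exact Finset.sum_congr rfl fun x hx => by rw [(Finset.mem_filter.1 hx).2]; ring
  rw [K.sum_eq_sum_vtype, ← Finset.sum_subset (Finset.subset_univ (K.freeTypes τ)), Finset.mul_sum]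
  · refine Finset.sum_congr rfl fun a _ => ?_
    rw [key, typeMean]
    field_simp [hτ.faceWeight_pos.ne']
  · intro a _ ha
    rw [key, K.sum_vtype_eq_zero ha, zero_mul]

theorem sum_vertexWeight_mul (hτ : K.IsFace τ) (c : Fin (d + 1) → ℝ) :
    ∑ x, K.vertexWeight τ x * c (K.vtype x) = K.faceWeight τ * ∑ a ∈ K.freeTypes τ, c a := by
  have := K.sum_vertexWeight_mul_mul hτ (fun _ => 1) c
  simp only [one_mul] at this
  rw [this]
  congr 1
  refine Finset.sum_congr rfl fun a ha => ?_
  simp only [typeMean, mul_one]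
  rw [sum_vertexWeight, if_pos ha, div_self hτ.faceWeight_pos.ne', one_mul]

theorem vertexWeight_mul_sum_erase (τ : Finset V) (m : Fin (d + 1) → ℝ) (x : V) :
    K.vertexWeight τ x * ∑ b ∈ (K.freeTypes τ).erase (K.vtype x), m b =
      K.vertexWeight τ x * (∑ b ∈ K.freeTypes τ, m b - m (K.vtype x)) := by
  by_cases h : K.vertexWeight τ x = 0
  · simp [h]
  · rw [← Finset.add_sum_erase _ m (vtype_mem_of_vertexWeight_ne_zero h)]; ring

variable {K} in
/-- The bound for mean-zero functions extends to all functions, with a correction for the means. -/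
theorem VarianceBound.edgeForm_le {h : Fin (d + 1) → ℝ} (hb : K.VarianceBound τ h)
    (hτ : K.IsFace τ) (f : V → ℝ) :
    K.edgeForm τ f ≤ ∑ x, K.vertexWeight τ x * (h (K.vtype x) * f x ^ 2) +
      K.faceWeight τ * ((∑ a ∈ K.freeTypes τ, K.typeMean τ f a) ^ 2 -
        ∑ a ∈ K.freeTypes τ, (1 + h a) * K.typeMean τ f a ^ 2) := by
  have hw := hτ.faceWeight_pos.ne'
  set m := K.typeMean τ f with hm
  set M := ∑ a ∈ K.freeTypes τ, m a with hM
  have h0 := hb (fun x => f x - m (K.vtype x)) (fun i => by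
    have : ∑ x with K.vtype x = i, K.vertexWeight τ x * (f x - m (K.vtype x)) =
        ∑ x with K.vtype x = i, K.vertexWeight τ x * f x -
          (∑ x with K.vtype x = i, K.vertexWeight τ x) * m i := by
      rw [Finset.sum_mul, ← Finset.sum_sub_distrib]
      exact Finset.sum_congr rfl fun x hx => by rw [(Finset.mem_filter.1 hx).2]; ring
    rw [this, sum_vertexWeight]
    split_ifs with hi
    · rw [hm, typeMean, mul_div_cancel₀ _ hw, sub_self]
    · rw [K.sum_vtype_eq_zero hi]; ring)
  have e1 : K.edgeForm τ (fun x => f x - m (K.vtype x)) = K.edgeForm τ f -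
      2 * (∑ x, ∑ y, K.edgeWeight τ x y * (f x * m (K.vtype y))) +
      ∑ x, ∑ y, K.edgeWeight τ x y * (m (K.vtype x) * m (K.vtype y)) := by
    have hsw : ∑ x, ∑ y, K.edgeWeight τ x y * (f x * m (K.vtype y)) =
        ∑ x, ∑ y, K.edgeWeight τ x y * (m (K.vtype x) * f y) := by
      rw [Finset.sum_comm]
      refine Finset.sum_congr rfl fun x _ => Finset.sum_congr rfl fun y _ => ?_
      rw [K.edgeWeight_comm]; ring
    rw [two_mul]
    nth_rewrite 1 [hsw]
    simp only [edgeForm, ← Finset.sum_add_distrib, ← Finset.sum_sub_distrib]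
    exact Finset.sum_congr rfl fun x _ => Finset.sum_congr rfl fun y _ => by ring
  have e2 : ∀ F : V → ℝ, ∑ x, ∑ y, K.edgeWeight τ x y * (F x * m (K.vtype y)) =
      ∑ x, K.vertexWeight τ x * (F x * (M - m (K.vtype x))) := fun F => by
    refine Finset.sum_congr rfl fun x _ => ?_
    have : ∑ y, K.edgeWeight τ x y * (F x * m (K.vtype y)) =
        F x * ∑ y, K.edgeWeight τ x y * m (K.vtype y) := by
      rw [Finset.mul_sum]; exact Finset.sum_congr rfl fun y _ => by ring
    rw [this, sum_edgeWeight_mul, vertexWeight_mul_sum_erase]; ring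
  have e3 : ∑ a ∈ K.freeTypes τ, m a * (M - m a) = M ^ 2 - ∑ a ∈ K.freeTypes τ, m a ^ 2 := by
    simp only [mul_sub, Finset.sum_sub_distrib, ← Finset.sum_mul, ← hM, pow_two]
  have e4 : ∑ x, K.vertexWeight τ x * (h (K.vtype x) * (f x - m (K.vtype x)) ^ 2) =
      ∑ x, K.vertexWeight τ x * (h (K.vtype x) * f x ^ 2) -
      2 * (∑ x, K.vertexWeight τ x * (f x * (h (K.vtype x) * m (K.vtype x)))) +
      ∑ x, K.vertexWeight τ x * (h (K.vtype x) * m (K.vtype x) ^ 2) := by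
    rw [Finset.mul_sum, ← Finset.sum_sub_distrib, ← Finset.sum_add_distrib]
    exact Finset.sum_congr rfl fun x _ => by ring
  have e5 : ∑ a ∈ K.freeTypes τ, (1 + h a) * m a ^ 2 =
      ∑ a ∈ K.freeTypes τ, m a ^ 2 + ∑ a ∈ K.freeTypes τ, h a * m a ^ 2 := by
    rw [← Finset.sum_add_distrib]; exact Finset.sum_congr rfl fun a _ => by ring
  have e6 : ∑ a ∈ K.freeTypes τ, m a * (h a * m a) = ∑ a ∈ K.freeTypes τ, h a * m a ^ 2 :=
    Finset.sum_congr rfl fun a _ => by ring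
  rw [e1, e4, e2 f, e2 fun x => m (K.vtype x),
    K.sum_vertexWeight_mul_mul hτ f (fun a => M - m a),
    K.sum_vertexWeight_mul hτ (fun a => m a * (M - m a)),
    K.sum_vertexWeight_mul_mul hτ f (fun a => h a * m a),
    K.sum_vertexWeight_mul hτ (fun a => h a * m a ^ 2), ← hm, e3, e6] at h0
  rw [e5]
  linarith

/-- Averaging the quadratic forms over the links of the vertices of the link of `τ`. -/
theorem sum_edgeForm_insert (τ : Finset V) (f : V → ℝ) :
    ∑ z, (if z ∈ τ then 0 else K.edgeForm (insert z τ) f) =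
      ((K.freeTypes τ).card - 2) * K.edgeForm τ f := by
  have h1 : ∀ z, (if z ∈ τ then 0 else K.edgeForm (insert z τ) f) =
      ∑ x, ∑ y, (if z ∈ τ then 0 else K.edgeWeight (insert z τ) x y) * (f x * f y) := fun z => by
    split_ifs <;> simp [edgeForm]
  simp only [h1]
  rw [Finset.sum_comm, edgeForm, Finset.mul_sum]
  refine Finset.sum_congr rfl fun x _ => ?_
  rw [Finset.sum_comm, Finset.mul_sum]
  refine Finset.sum_congr rfl fun y _ => ?_
  rw [← Finset.sum_mul, ← mul_assoc (((K.freeTypes τ).card : ℝ) - 2)]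
  congr 1
  rw [K.sum_eq_sum_vtype]
  simp only [sum_edgeWeight_insert]
  rw [Finset.sum_ite_mem, Finset.univ_inter, Finset.sum_const, nsmul_eq_mul]
  by_cases h : K.edgeWeight τ x y = 0
  · simp [h]
  · obtain ⟨hx, hy, hxy⟩ := vtype_mem_of_edgeWeight_ne_zero h
    have hy' := Finset.mem_erase.2 ⟨hxy.symm, hy⟩
    rw [Finset.card_erase_of_mem hy', Nat.cast_pred (Finset.card_pos.2 ⟨_, hy'⟩),
      Finset.card_erase_of_mem hx, Nat.cast_pred (Finset.card_pos.2 ⟨_, hx⟩)]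
    ring

theorem sum_typeMean_insert (hz : z ∉ τ) (f : V → ℝ) :
    ∑ a ∈ K.freeTypes (insert z τ), K.typeMean (insert z τ) f a = K.linkOp τ f z := by
  simp only [typeMean]
  rw [← Finset.sum_div, linkOp_apply, K.vertexWeight_of_notMem hz, K.sum_eq_sum_vtype]
  congr 1
  simp only [K.edgeWeight_of_notMem hz]
  exact Finset.sum_subset (Finset.subset_univ _) fun a _ ha => K.sum_vtype_eq_zero ha f

/-- Garland-type localization of the quadratic form of the link of `τ` to the links of its
vertices. -/
theorem localization (h : V → Fin (d + 1) → ℝ)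
    (hb : ∀ z, K.vertexWeight τ z ≠ 0 → K.VarianceBound (insert z τ) (h z)) (f : V → ℝ) :
    ((K.freeTypes τ).card - 2) * K.edgeForm τ f ≤
      ∑ z, ∑ x, K.edgeWeight τ z x * (h z (K.vtype x) * f x ^ 2) +
      ∑ z, K.vertexWeight τ z * (K.linkOp τ f z ^ 2 -
        ∑ a ∈ K.freeTypes (insert z τ), (1 + h z a) * K.typeMean (insert z τ) f a ^ 2) := by
  rw [← sum_edgeForm_insert, ← Finset.sum_add_distrib]
  refine Finset.sum_le_sum fun z _ => ?_
  by_cases hz : z ∈ τ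
  · simp [hz, edgeWeight, K.vertexWeight_of_mem hz]
  · rw [if_neg hz]
    by_cases hp : K.vertexWeight τ z = 0
    · have h0 : ∀ x y, K.edgeWeight (insert z τ) x y = 0 := fun x y =>
        K.edgeWeight_eq_zero_of_vertexWeight (by
          rw [← K.edgeWeight_of_notMem hz]; exact K.edgeWeight_eq_zero_of_vertexWeight hp)
      simp [edgeForm, h0, hp, K.edgeWeight_eq_zero_of_vertexWeight hp]
    · have := (hb z hp).edgeForm_le (isFace_insert_of_vertexWeight_ne_zero hp).2 f
      rw [K.sum_typeMean_insert hz, ← K.vertexWeight_of_notMem hz] at this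
      simpa only [K.edgeWeight_of_notMem hz] using this

/-- Functions on the vertices of the link of `τ` with mean zero on every part. -/
def meanZeroSubmodule (τ : Finset V) : Submodule ℝ (V → ℝ) where
  carrier := {f | (∀ x, K.vertexWeight τ x = 0 → f x = 0) ∧ K.MeanZero τ f}
  add_mem' := by
    rintro f g ⟨hf, hf'⟩ ⟨hg, hg'⟩
    refine ⟨fun x hx => by simp [hf x hx, hg x hx], fun i => ?_⟩
    simp only [Pi.add_apply, mul_add, Finset.sum_add_distrib, hf' i, hg' i, add_zero]
  zero_mem' := ⟨fun _ _ => rfl, fun i => by simp⟩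
  smul_mem' := by
    rintro r f ⟨hf, hf'⟩
    refine ⟨fun x hx => by simp [hf x hx], fun i => ?_⟩
    simp only [Pi.smul_apply, smul_eq_mul, mul_left_comm _ r, ← Finset.mul_sum, hf' i, mul_zero]

variable {f g : V → ℝ}

variable {K} in
theorem MeanZero.typeMean_eq_zero (hf : K.MeanZero τ f) (a : Fin (d + 1)) :
    K.typeMean τ f a = 0 := by
  rw [typeMean, hf a, zero_div]

variable {K} in
theorem MeanZero.mul_vtype (hf : K.MeanZero τ f) (c : Fin (d + 1) → ℝ) :
    K.MeanZero τ fun x => c (K.vtype x) * f x := fun i => by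
  rw [← mul_zero (c i), ← hf i, Finset.mul_sum]
  refine Finset.sum_congr rfl fun x hx => ?_
  simp only [(Finset.mem_filter.1 hx).2]
  ring

theorem sum_linkOp_vtype (hτ : K.IsFace τ) (f : V → ℝ) {i : Fin (d + 1)}
    (hi : i ∈ K.freeTypes τ) :
    ∑ x with K.vtype x = i, K.vertexWeight τ x * K.linkOp τ f x =
      K.faceWeight τ * ∑ a ∈ (K.freeTypes τ).erase i, K.typeMean τ f a := by
  simp only [vertexWeight_mul_linkOp]
  rw [Finset.sum_comm]
  have h : ∀ y, ∑ x with K.vtype x = i, K.edgeWeight τ x y * f y =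
      K.vertexWeight τ y * (f y * if K.vtype y = i then 0 else 1) := fun y => by
    rw [← Finset.sum_mul]
    simp only [K.edgeWeight_comm τ _ y]
    rw [sum_edgeWeight]
    by_cases h : K.vtype y = i
    · simp [h]
    · rw [if_pos (Finset.mem_erase.2 ⟨Ne.symm h, hi⟩), if_neg h, mul_one]
  simp only [h]
  rw [K.sum_vertexWeight_mul_mul hτ f (fun a => if a = i then 0 else 1),
    ← Finset.add_sum_erase _ _ hi, if_pos rfl, mul_zero, zero_add]
  congr 1
  exact Finset.sum_congr rfl fun a ha => by rw [if_neg (Finset.ne_of_mem_erase ha), mul_one]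

theorem linkOp_mem (hτ : K.IsFace τ) (hf : f ∈ K.meanZeroSubmodule τ) :
    K.linkOp τ f ∈ K.meanZeroSubmodule τ := by
  refine ⟨fun x hx => by rw [linkOp_apply, hx, div_zero], fun i => ?_⟩
  by_cases hi : i ∈ K.freeTypes τ
  · rw [K.sum_linkOp_vtype hτ f hi]
    simp [hf.2.typeMean_eq_zero]
  · exact K.sum_vtype_eq_zero hi _

theorem linkOp_symm (τ : Finset V) (f g : V → ℝ) :
    ∑ x, K.vertexWeight τ x * (K.linkOp τ f x * g x) =
      ∑ x, K.vertexWeight τ x * (f x * K.linkOp τ g x) := by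
  have h1 : ∀ x, K.vertexWeight τ x * (K.linkOp τ f x * g x) =
      ∑ y, K.edgeWeight τ x y * (f y * g x) := fun x => by
    rw [← mul_assoc, vertexWeight_mul_linkOp, Finset.sum_mul]
    exact Finset.sum_congr rfl fun y _ => by ring
  have h2 : ∀ x, K.vertexWeight τ x * (f x * K.linkOp τ g x) =
      ∑ y, K.edgeWeight τ y x * (f x * g y) := fun x => by
    rw [mul_left_comm, vertexWeight_mul_linkOp, Finset.mul_sum]
    exact Finset.sum_congr rfl fun y _ => by rw [K.edgeWeight_comm]; ring
  simp only [h1, h2]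
  rw [Finset.sum_comm]

variable {K} in
theorem edgeForm_congr (h : ∀ x, K.vertexWeight τ x ≠ 0 → f x = g x) :
    K.edgeForm τ f = K.edgeForm τ g := by
  refine Finset.sum_congr rfl fun x _ => Finset.sum_congr rfl fun y _ => ?_
  by_cases hx : K.vertexWeight τ x = 0
  · simp [K.edgeWeight_eq_zero_of_vertexWeight hx]
  by_cases hy : K.vertexWeight τ y = 0
  · simp [K.edgeWeight_eq_zero_of_vertexWeight_right hy]
  rw [h x hx, h y hy]

variable {K} in
theorem varianceBound_of_forall_mem {h : Fin (d + 1) → ℝ}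
    (H : ∀ f ∈ K.meanZeroSubmodule τ,
      K.edgeForm τ f ≤ ∑ x, K.vertexWeight τ x * (h (K.vtype x) * f x ^ 2)) :
    K.VarianceBound τ h := fun f hf => by
  have hg : ∀ x, K.vertexWeight τ x ≠ 0 → (if K.vertexWeight τ x = 0 then 0 else f x) = f x :=
    fun x hx => if_neg hx
  have hp : ∀ x (F : ℝ → ℝ), K.vertexWeight τ x * F (if K.vertexWeight τ x = 0 then 0 else f x) =
      K.vertexWeight τ x * F (f x) := fun x F => by
    by_cases hx : K.vertexWeight τ x = 0
    · simp [hx]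
    · rw [hg x hx]
  have := H (fun x => if K.vertexWeight τ x = 0 then 0 else f x)
    ⟨fun x hx => if_pos hx, fun i => by
      exact (Finset.sum_congr rfl fun x _ => hp x id).trans (hf i)⟩
  rw [edgeForm_congr hg] at this
  exact this.trans_eq (Finset.sum_congr rfl fun x _ => hp x fun t => h (K.vtype x) * t ^ 2)

variable {K} in
theorem VarianceBound.mono {h h' : Fin (d + 1) → ℝ} (hb : K.VarianceBound τ h)
    (hh : ∀ i ∈ K.freeTypes τ, h i ≤ h' i) : K.VarianceBound τ h' := fun f hf =>
  (hb f hf).trans <| Finset.sum_le_sum fun x _ => by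
    by_cases hx : K.vertexWeight τ x = 0
    · simp [hx]
    · exact mul_le_mul_of_nonneg_left (mul_le_mul_of_nonneg_right
        (hh _ (vtype_mem_of_vertexWeight_ne_zero hx)) (sq_nonneg _)) (K.vertexWeight_nonneg _ _)

/-- A spectral criterion for bounds on the quadratic form of the link of `τ`. -/
theorem varianceBound_of_eigenvalue_nonpos (hτ : K.IsFace τ) {h : Fin (d + 1) → ℝ}
    (hc : ∀ f ∈ K.meanZeroSubmodule τ, f ≠ 0 → ∀ μ : ℝ,
      (∀ x, K.linkOp τ f x = h (K.vtype x) * f x + μ * f x) → μ ≤ 0) :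
    K.VarianceBound τ h := by
  refine varianceBound_of_forall_mem fun f hf => ?_
  let D : (V → ℝ) →ₗ[ℝ] (V → ℝ) :=
    { toFun := fun f x => h (K.vtype x) * f x
      map_add' := fun f g => by ext x; simp [mul_add]
      map_smul' := fun r f => by ext x; simp [mul_left_comm] }
  have hD : ∀ f x, D f x = h (K.vtype x) * f x := fun _ _ => rfl
  have key := weighted_quadratic_le_of_eigenvalue_le (K.vertexWeight τ)
    (K.vertexWeight_nonneg τ) (K.meanZeroSubmodule τ) (fun f hf => hf.1) (K.linkOp τ - D)
    (fun f hf => Submodule.sub_mem _ (K.linkOp_mem hτ hf)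
      ⟨fun x hx => by rw [hD, hf.1 x hx, mul_zero], hf.2.mul_vtype h⟩)
    (fun f g => by
      simp only [LinearMap.sub_apply, Pi.sub_apply, sub_mul, mul_sub, Finset.sum_sub_distrib,
        K.linkOp_symm τ f g, hD]
      congr 1
      exact Finset.sum_congr rfl fun x _ => by ring)
    (c := 0) (fun f hf h0 μ hμ => hc f hf h0 μ fun x => by
      have := congrFun hμ x
      simp only [LinearMap.sub_apply, Pi.sub_apply, hD, Pi.smul_apply, smul_eq_mul] at this
      linarith) hf
  simp only [LinearMap.sub_apply, Pi.sub_apply, hD, sub_mul, mul_sub, Finset.sum_sub_distrib,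
    zero_mul, sub_nonpos, ← K.edgeForm_eq τ f] at key
  exact key.trans_eq (Finset.sum_congr rfl fun x _ => by ring)

/-- A nonzero function on the link of `τ` has positive norm. -/
theorem sum_sq_pos (hf : f ∈ K.meanZeroSubmodule τ) (h0 : f ≠ 0) :
    0 < ∑ x, K.vertexWeight τ x * f x ^ 2 := by
  obtain ⟨x, hx⟩ := Function.ne_iff.1 h0
  have hp : K.vertexWeight τ x ≠ 0 := fun h => hx (hf.1 x h)
  refine Finset.sum_pos' (fun x _ => mul_nonneg (K.vertexWeight_nonneg _ _) (sq_nonneg _))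
    ⟨x, Finset.mem_univ _, mul_pos ((K.vertexWeight_nonneg _ _).lt_of_ne' hp)
      (pow_two_pos_of_ne_zero hx)⟩

theorem sum_edgeWeight_mul_sub_sq (τ : Finset V) (f : V → ℝ) :
    ∑ x, ∑ y, K.edgeWeight τ x y * (f x - f y) ^ 2 =
      2 * ((((K.freeTypes τ).card : ℝ) - 1) * ∑ x, K.vertexWeight τ x * f x ^ 2 -
        K.edgeForm τ f) := by
  have h1 : ∑ x, ∑ y, K.edgeWeight τ x y * f x ^ 2 =
      (((K.freeTypes τ).card : ℝ) - 1) * ∑ x, K.vertexWeight τ x * f x ^ 2 := by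
    rw [Finset.mul_sum]
    exact Finset.sum_congr rfl fun x _ => by
      rw [← Finset.sum_mul, sum_edgeWeight_right, mul_assoc]
  have h2 : ∑ x, ∑ y, K.edgeWeight τ x y * f y ^ 2 =
      ∑ x, ∑ y, K.edgeWeight τ x y * f x ^ 2 := by
    rw [Finset.sum_comm]
    exact Finset.sum_congr rfl fun x _ => Finset.sum_congr rfl fun y _ => by
      rw [K.edgeWeight_comm]
  have h3 : ∑ x, ∑ y, K.edgeWeight τ x y * (f x - f y) ^ 2 =
      ∑ x, ∑ y, K.edgeWeight τ x y * f x ^ 2 + ∑ x, ∑ y, K.edgeWeight τ x y * f y ^ 2 -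
        2 * K.edgeForm τ f := by
    simp only [edgeForm, Finset.mul_sum, ← Finset.sum_add_distrib, ← Finset.sum_sub_distrib]
    exact Finset.sum_congr rfl fun x _ => Finset.sum_congr rfl fun y _ => by ring
  rw [h3, h2, h1]; ring

/-- Connectedness of the link excludes the trivial eigenvalue on mean-zero functions. -/
theorem eigenvalue_lt (hconn : K.TotallyConnected) (hτ : K.IsFace τ)
    (hk : 2 ≤ (K.freeTypes τ).card) (hf : f ∈ K.meanZeroSubmodule τ) (h0 : f ≠ 0) {μ : ℝ}
    (hμ : ∀ x, K.linkOp τ f x = μ * f x) : μ < (K.freeTypes τ).card - 1 := by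
  by_contra! hle
  have hform : K.edgeForm τ f = μ * ∑ x, K.vertexWeight τ x * f x ^ 2 := by
    rw [edgeForm_eq, Finset.mul_sum]
    exact Finset.sum_congr rfl fun x _ => by rw [hμ]; ring
  have hsum := K.sum_edgeWeight_mul_sub_sq τ f
  have hnn : ∀ x y, 0 ≤ K.edgeWeight τ x y * (f x - f y) ^ 2 := fun x y =>
    mul_nonneg (K.edgeWeight_nonneg _ _ _) (sq_nonneg _)
  have hzero : ∑ x, ∑ y, K.edgeWeight τ x y * (f x - f y) ^ 2 = 0 := by
    refine le_antisymm ?_ (Finset.sum_nonneg fun x _ => Finset.sum_nonneg fun y _ => hnn x y)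
    rw [hsum, hform]
    nlinarith [K.sum_sq_pos hf h0]
  have hedge : ∀ x y, 0 < K.linkWeight τ x y → f x = f y := fun x y hxy => by
    have h1 := (Finset.sum_eq_zero_iff_of_nonneg fun x _ =>
      Finset.sum_nonneg fun y _ => hnn x y).1 hzero x (Finset.mem_univ _)
    have h2 := (Finset.sum_eq_zero_iff_of_nonneg fun y _ => hnn x y).1 h1 y (Finset.mem_univ _)
    rw [linkWeight_eq] at hxy
    rcases mul_eq_zero.1 h2 with h | h
    · simp [h] at hxy
    · exact sub_eq_zero.1 (pow_eq_zero_iff two_ne_zero |>.1 h)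
  obtain ⟨x, hx⟩ := Function.ne_iff.1 h0
  have hp : K.vertexWeight τ x ≠ 0 := fun h => hx (hf.1 x h)
  have hconst : ∀ y, K.vertexWeight τ y ≠ 0 → f x = f y := fun y hy => by
    obtain ⟨hx, hxf⟩ := isFace_insert_of_vertexWeight_ne_zero hp
    obtain ⟨hy, hyf⟩ := isFace_insert_of_vertexWeight_ne_zero hy
    have := hconn τ hτ (by have := hτ.card_freeTypes; omega) x y hx hxf hy hyf
    induction this with
    | refl => rfl
    | @tail b c _ h ih =>
      have hbc : K.edgeWeight τ b c ≠ 0 := fun h' => by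
        rw [linkWeight_eq, h', zero_div] at h
        exact h.false
      obtain ⟨-, hb, -, hbf⟩ := of_edgeWeight_ne_zero hbc
      have hb' := hbf.mono (σ := insert b τ) (by grind)
      exact (ih (K.vertexWeight_pos hb hb').ne' hb hb').trans (hedge _ _ h)
  have hm := hf.2 (K.vtype x)
  have : ∑ y with K.vtype y = K.vtype x, K.vertexWeight τ y * f y =
      (∑ y with K.vtype y = K.vtype x, K.vertexWeight τ y) * f x := by
    rw [Finset.sum_mul]
    refine Finset.sum_congr rfl fun y _ => ?_
    by_cases hy : K.vertexWeight τ y = 0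
    · simp [hy]
    · rw [hconst y hy]
  rw [this, sum_vertexWeight, if_pos (vtype_mem_of_vertexWeight_ne_zero hp)] at hm
  rcases mul_eq_zero.1 hm with h | h
  · exact hτ.faceWeight_pos.ne' h
  · exact hx h

theorem walkMatrix_mulVec (hτ : K.IsFace τ) (f : V → ℝ) (x : V) :
    (K.walkMatrix τ).mulVec f x = K.linkOp τ f x / ((K.freeTypes τ).card - 1) := by
  simp only [Matrix.mulVec, dotProduct, K.walkMatrix_apply hτ, linkOp_apply]
  rw [div_div, Finset.sum_div]
  exact Finset.sum_congr rfl fun y _ => by ring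

/-- In co-dimension two the second eigenvalue of the walk bounds the quadratic form. -/
theorem varianceBound_lambda2 (hconn : K.TotallyConnected) (hτ : K.IsFace τ)
    (hk : (K.freeTypes τ).card = 2) :
    K.VarianceBound τ fun _ => lambda2 (K.walkMatrix τ) := by
  refine K.varianceBound_of_eigenvalue_nonpos hτ fun f hf h0 μ hμ => ?_
  simp only [← add_mul] at hμ
  have hlt := K.eigenvalue_lt hconn hτ hk.ge hf h0 hμ
  have hmem : lambda2 (K.walkMatrix τ) + μ ∈ {μ : ℝ | μ < 1 ∧ μ ∈ spectrum ℝ (K.walkMatrix τ)} := by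
    refine ⟨by rw [hk] at hlt; norm_num at hlt; exact hlt,
      Matrix.mem_spectrum_iff_exists_mulVec.2 ⟨f, h0, funext fun x => ?_⟩⟩
    rw [K.walkMatrix_mulVec hτ, hμ, hk]
    norm_num
  have := le_csSup ⟨1, fun r hr => hr.1.le⟩ hmem
  rw [← lambda2] at this
  linarith

open Classical in
/-- The types `j ≠ i` with `ε_{i,j} > 0`. -/
noncomputable def dependentTypes (i : Fin (d + 1)) : Finset (Fin (d + 1)) :=
  Finset.univ.filter fun j => j ≠ i ∧ 0 < K.eps i j

theorem eps_comm (i j : Fin (d + 1)) : K.eps i j = K.eps j i := by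
  simp only [eps, Finset.pair_comm]

theorem mem_dependentTypes_symm {i j : Fin (d + 1)} (h : j ∈ K.dependentTypes i) :
    i ∈ K.dependentTypes j := by
  simp only [dependentTypes, Finset.mem_filter, Finset.mem_univ, true_and] at h ⊢
  exact ⟨h.1.symm, K.eps_comm i j ▸ h.2⟩

theorem card_dependentTypes_le (i : Fin (d + 1)) : (K.dependentTypes i).card ≤ K.DeltaMax := by
  have : (K.dependentTypes i).card = K.DeltaAt i := by
    rw [DeltaAt, ← Set.ncard_coe_finset]
    congr 1
    ext j
    simp [dependentTypes]
  exact this ▸ Finset.le_sup (f := fun i => K.DeltaAt i) (Finset.mem_univ i)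

theorem lambda2_nonpos_of_notMem (hτ : K.IsFace τ) {i j : Fin (d + 1)} (hij : i ≠ j)
    (hS : K.freeTypes τ = {i, j}) (hj : j ∉ K.dependentTypes i) :
    lambda2 (K.walkMatrix τ) ≤ 0 := by
  have hle : K.eps i j ≤ 0 := by
    simpa [dependentTypes, hij.symm] using hj
  have hτ' : τ.image K.vtype = Finset.univ \ {i, j} := by rw [← hS, freeTypes]; simp
  refine (le_csSup ?_ (Set.mem_ofPred.2 ⟨τ, hτ, hτ', rfl⟩)).trans hle
  refine ((Set.finite_range fun τ : Finset V => lambda2 (K.walkMatrix τ)).subset ?_).bddAbove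
  rintro _ ⟨σ, -, -, rfl⟩
  exact ⟨σ, rfl⟩

/-- Functions constant along the edges between types in `B` are constant on the vertices of types
in `B`. -/
theorem eq_of_forall_edge_eq (hconn : K.TotallyConnected) {B : Finset (Fin (d + 1))}
    (hB : 2 ≤ B.card) (φ : V → ℝ) (τ : Finset V) (hτ : K.IsFace τ) (hS : B ⊆ K.freeTypes τ)
    (hφ : ∀ a b, K.edgeWeight τ a b ≠ 0 → K.vtype a ∈ B → K.vtype b ∈ B → φ a = φ b)
    {y y' : V} (hy : K.vertexWeight τ y ≠ 0) (hy' : K.vertexWeight τ y' ≠ 0)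
    (hyB : K.vtype y ∈ B) (hyB' : K.vtype y' ∈ B) : φ y' = φ y := by
  induction hn : (K.freeTypes τ).card using Nat.strong_induction_on generalizing τ y y' with
  | _ n ih =>
  have hk : τ.card + 2 ≤ d + 1 := by
    have := hτ.card_freeTypes
    have := Finset.card_le_card hS
    omega
  obtain ⟨hyτ, hyf⟩ := isFace_insert_of_vertexWeight_ne_zero hy
  obtain ⟨hyτ', hyf'⟩ := isFace_insert_of_vertexWeight_ne_zero hy'
  suffices H : ∀ v, Relation.ReflTransGen (fun a b => 0 < K.linkWeight τ a b) y v →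
      ∀ u, K.vtype u ∈ B → (u = v ∨ K.edgeWeight τ v u ≠ 0) → φ u = φ y from
    H y' (hconn τ hτ hk y y' hyτ hyf hyτ' hyf') y' hyB' (Or.inl rfl)
  intro v hv
  induction hv with
  | refl =>
    rintro u hu (rfl | h)
    · rfl
    · exact (hφ _ _ h hyB hu).symm
  | @tail v v' _ h ihv =>
    have hvv : K.edgeWeight τ v v' ≠ 0 := fun h' => by
      rw [linkWeight_eq, h', zero_div] at h
      exact h.false
    intro u hu huv
    by_cases hvB : K.vtype v' ∈ B
    · have h1 := ihv v' hvB (Or.inr hvv)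
      rcases huv with rfl | huv
      · exact h1
      · exact (hφ _ _ huv hvB hu).symm.trans h1
    · have huv : K.edgeWeight τ v' u ≠ 0 := huv.resolve_left fun h => hvB (h ▸ hu)
      obtain ⟨-, hvτ, hvτ', η, hη, hsub⟩ := of_edgeWeight_ne_zero hvv
      obtain ⟨u₀, hu₀, hu₀B⟩ := K.exists_mem_vtype hη (K.vtype u)
      have hu₀B' : K.vtype u₀ ∈ B := hu₀B ▸ hu
      have hu₀τ := notMem_of_vtype_mem_freeTypes (hS hu₀B')
      have hne : u₀ ≠ v' := fun h => hvB (h ▸ hu₀B')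
      have h0 : φ u₀ = φ y := by
        refine ihv u₀ hu₀B' (or_iff_not_imp_left.2 fun hne' => ?_)
        exact (K.edgeWeight_pos (Ne.symm hne') hvτ hu₀τ ⟨η, hη, by grind⟩).ne'
      have hfree := vtype_mem_of_edgeWeight_ne_zero hvv
      rw [← h0]
      refine ih _ ?_ (insert v' τ) ⟨η, hη, by grind⟩ ?_ ?_ ?_ ?_ hu₀B' hu rfl
      · rw [freeTypes_insert, ← hn]
        exact Finset.card_erase_lt_of_mem hfree.2.1
      · rw [freeTypes_insert]
        exact fun i hi => Finset.mem_erase.2 ⟨fun h => hvB (h ▸ hi), hS hi⟩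
      · intro a b hab
        obtain ⟨hne, ha, hb, hf⟩ := of_edgeWeight_ne_zero hab
        exact hφ a b (K.edgeWeight_pos hne (by grind) (by grind) (hf.mono (by grind))).ne'
      · exact (K.vertexWeight_pos (by grind) ⟨η, hη, by grind⟩).ne'
      · rwa [← K.edgeWeight_of_notMem hvτ']

theorem edgeWeight_mul_of_varianceBound_zero (hτ : K.IsFace τ)
    (hS : K.freeTypes τ = {K.vtype x, K.vtype y}) (hxy : K.vtype x ≠ K.vtype y)
    (hb : K.VarianceBound τ fun _ => 0) :
    K.edgeWeight τ x y * K.faceWeight τ = K.vertexWeight τ x * K.vertexWeight τ y := by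
  have hw := hτ.faceWeight_pos
  have hne : x ≠ y := fun h => hxy (h ▸ rfl)
  have hxx : ∀ x, K.edgeWeight τ x x = 0 := fun x => by rw [edgeWeight_eq_ite, if_pos (by simp)]
  have key : ∀ s : ℝ, s * K.edgeWeight τ x y ≤
      s * (K.vertexWeight τ x * K.vertexWeight τ y / K.faceWeight τ) := fun s => by
    have h := hb.edgeForm_le hτ (fun z => (if z = x then 1 else 0) + (if z = y then s else 0))
    have e1 : K.edgeForm τ (fun z => (if z = x then 1 else 0) + (if z = y then s else 0)) =
        2 * (s * K.edgeWeight τ x y) := by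
      simp only [edgeForm, add_mul, mul_add, Finset.sum_add_distrib, ite_mul, mul_ite, mul_zero,
        zero_mul, mul_one, one_mul, Finset.sum_ite_eq', Finset.mem_univ, if_true]
      simp [hxx, K.edgeWeight_comm τ y x]
      ring
    have e2 : K.typeMean τ (fun z => (if z = x then 1 else 0) + (if z = y then s else 0))
        (K.vtype x) = K.vertexWeight τ x / K.faceWeight τ := by
      simp [typeMean, mul_add, Finset.sum_add_distrib, hxy.symm]
    have e3 : K.typeMean τ (fun z => (if z = x then 1 else 0) + (if z = y then s else 0))
        (K.vtype y) = s * K.vertexWeight τ y / K.faceWeight τ := by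
      simp [typeMean, mul_add, Finset.sum_add_distrib, hxy, mul_comm s]
    rw [e1, hS, Finset.sum_pair hxy, Finset.sum_pair hxy, e2, e3] at h
    simp only [zero_mul, mul_zero, Finset.sum_const_zero, add_zero, one_mul, zero_add] at h
    have : K.faceWeight τ * ((K.vertexWeight τ x / K.faceWeight τ +
        s * K.vertexWeight τ y / K.faceWeight τ) ^ 2 - ((K.vertexWeight τ x / K.faceWeight τ) ^ 2 +
        (s * K.vertexWeight τ y / K.faceWeight τ) ^ 2)) =
        2 * (s * (K.vertexWeight τ x * K.vertexWeight τ y / K.faceWeight τ)) := by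
      field_simp
      ring
    linarith
  have h1 := key 1
  have h2 := key (-1)
  rw [← eq_div_iff hw.ne']
  linarith

/-- Types in `A` are independent of types in `B` when no pair across is dependent. -/
theorem edgeWeight_mul_faceWeight (hconn : K.TotallyConnected)
    (N : Fin (d + 1) → Finset (Fin (d + 1))) (hsymm : ∀ i j, j ∈ N i → i ∈ N j)
    (hN : ∀ τ i j, K.IsFace τ → i ≠ j → K.freeTypes τ = {i, j} → j ∉ N i →
      K.VarianceBound τ fun _ => 0) (τ : Finset V) (hτ : K.IsFace τ) (A B : Finset (Fin (d + 1)))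
    (hAB : Disjoint A B) (hS : K.freeTypes τ = A ∪ B) (hdep : ∀ i ∈ A, ∀ j ∈ B, j ∉ N i)
    (hx : K.vtype x ∈ A) (hy : K.vtype y ∈ B) :
    K.edgeWeight τ x y * K.faceWeight τ = K.vertexWeight τ x * K.vertexWeight τ y := by
  induction hn : (K.freeTypes τ).card using Nat.strong_induction_on generalizing τ A B x y with
  | _ n ih =>
  have main : ∀ (A B : Finset (Fin (d + 1))) (x y : V), Disjoint A B → K.freeTypes τ = A ∪ B →
      (∀ i ∈ A, ∀ j ∈ B, j ∉ N i) → K.vtype x ∈ A → K.vtype y ∈ B → 2 ≤ B.card →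
      K.edgeWeight τ x y * K.faceWeight τ = K.vertexWeight τ x * K.vertexWeight τ y := by
    intro A B x y hAB hS hdep hx hy hB
    have hBS : B ⊆ K.freeTypes τ := hS ▸ Finset.subset_union_right
    have hxS : K.vtype x ∈ K.freeTypes τ := hS ▸ Finset.mem_union_left _ hx
    have hxτ := notMem_of_vtype_mem_freeTypes hxS
    have hxne : ∀ z, K.vtype z ∈ B → x ≠ z := fun z hz h =>
      Finset.disjoint_left.1 hAB hx (h ▸ hz)
    have hstep : ∀ z z', K.edgeWeight τ z z' ≠ 0 → K.vtype z ∈ B → K.vtype z' ∈ B →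
        K.edgeWeight (insert z τ) x z' * K.vertexWeight τ z =
          K.edgeWeight τ z x * K.edgeWeight τ z z' := by
      intro z z' hzz hz hz'
      obtain ⟨-, hzτ, hzτ', hf⟩ := of_edgeWeight_ne_zero hzz
      have hty := (vtype_mem_of_edgeWeight_ne_zero hzz).2.2
      rw [K.vertexWeight_of_notMem hzτ, K.edgeWeight_of_notMem hzτ, K.edgeWeight_of_notMem hzτ]
      refine ih _ ?_ (insert z τ)
        (hf.mono (Finset.insert_subset_insert _ (Finset.subset_insert _ _))) A (B.erase (K.vtype z))
        (hAB.mono_right (Finset.erase_subset _ _)) ?_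
        (fun i hi j hj => hdep i hi j (Finset.mem_of_mem_erase hj)) hx
        (Finset.mem_erase.2 ⟨hty.symm, hz'⟩) rfl
      · rw [freeTypes_insert, ← hn]
        exact Finset.card_erase_lt_of_mem (hBS hz)
      · rw [freeTypes_insert, hS, Finset.erase_union_distrib,
          Finset.erase_eq_of_notMem (Finset.disjoint_right.1 hAB hz)]
    have hconst : ∀ z, K.vertexWeight τ z ≠ 0 → K.vertexWeight τ y ≠ 0 → K.vtype z ∈ B →
        K.edgeWeight τ z x / K.vertexWeight τ z = K.edgeWeight τ y x / K.vertexWeight τ y := by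
      intro z hz hy' hzB
      refine K.eq_of_forall_edge_eq hconn hB (fun z => K.edgeWeight τ z x / K.vertexWeight τ z) τ hτ
        hBS (fun a b hab ha hb => ?_) hy' hz hy hzB
      have h1 := hstep a b hab ha hb
      have h2 := hstep b a (K.edgeWeight_comm τ a b ▸ hab) hb ha
      have h3 : K.edgeWeight (insert a τ) x b = K.edgeWeight (insert b τ) x a := by
        obtain ⟨hne, ha', hb', -⟩ := of_edgeWeight_ne_zero hab
        have hxa := hxne a ha
        have hxb := hxne b hb
        rw [K.edgeWeight_eq_ite, K.edgeWeight_eq_ite, if_neg (by grind), if_neg (by grind),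
          Finset.insert_comm b a]
      have ha0 : K.vertexWeight τ a ≠ 0 := fun h => hab (K.edgeWeight_eq_zero_of_vertexWeight h)
      have hb0 : K.vertexWeight τ b ≠ 0 := fun h =>
        hab (K.edgeWeight_eq_zero_of_vertexWeight_right h)
      rw [K.edgeWeight_comm τ b a, ← h3] at h2
      rw [div_eq_div_iff ha0 hb0]
      refine mul_right_cancel₀ hab ?_
      linear_combination K.vertexWeight τ a * h2 - K.vertexWeight τ b * h1
    have hne : K.vtype x ≠ K.vtype y := fun h => Finset.disjoint_left.1 hAB hx (h ▸ hy)
    by_cases hy0 : K.vertexWeight τ y = 0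
    · rw [hy0, K.edgeWeight_eq_zero_of_vertexWeight_right hy0]; ring
    have hall : ∀ z ∈ Finset.univ.filter (fun z => K.vtype z = K.vtype y),
        K.edgeWeight τ x z * K.vertexWeight τ y = K.edgeWeight τ x y * K.vertexWeight τ z := by
      intro z hz
      have hzB : K.vtype z ∈ B := (Finset.mem_filter.1 hz).2 ▸ hy
      by_cases hz0 : K.vertexWeight τ z = 0
      · rw [hz0, K.edgeWeight_eq_zero_of_vertexWeight_right hz0]; ring
      · have := hconst z hz0 hy0 hzB
        rw [div_eq_div_iff hz0 hy0] at this
        rw [K.edgeWeight_comm τ x z, K.edgeWeight_comm τ x y, this]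
    have hsum := Finset.sum_congr rfl hall
    rw [← Finset.sum_mul, ← Finset.mul_sum, sum_edgeWeight, sum_vertexWeight, if_pos (hBS hy),
      if_pos (Finset.mem_erase.2 ⟨hne.symm, hBS hy⟩)] at hsum
    exact hsum.symm
  by_cases hB : 2 ≤ B.card
  · exact main A B x y hAB hS hdep hx hy hB
  by_cases hA : 2 ≤ A.card
  · rw [K.edgeWeight_comm, main B A y x hAB.symm (hS.trans (Finset.union_comm _ _))
      (fun i hi j hj h => hdep j hj i hi (hsymm _ _ h)) hy hx hA, mul_comm]
  have hA1 : A = {K.vtype x} :=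
    ((Finset.card_eq_one (s := A)).1 (by have := A.card_pos.2 ⟨_, hx⟩; omega)).elim fun a ha => by
      rw [ha, Finset.mem_singleton] at hx; rw [ha, hx]
  have hB1 : B = {K.vtype y} :=
    ((Finset.card_eq_one (s := B)).1 (by have := B.card_pos.2 ⟨_, hy⟩; omega)).elim fun a ha => by
      rw [ha, Finset.mem_singleton] at hy; rw [ha, hy]
  have hne : K.vtype x ≠ K.vtype y := fun h => Finset.disjoint_left.1 hAB hx (h ▸ hy)
  have hS' : K.freeTypes τ = {K.vtype x, K.vtype y} := by rw [hS, hA1, hB1]; rfl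
  exact K.edgeWeight_mul_of_varianceBound_zero hτ hS' hne
    (hN τ _ _ hτ hne hS' (hdep _ hx _ hy))

variable {K} in
theorem MeanZero.sum_eq_zero (hf : K.MeanZero τ f) : ∑ x, K.vertexWeight τ x * f x = 0 := by
  rw [K.sum_eq_sum_vtype]
  exact Finset.sum_eq_zero fun i _ => hf i

/-- A function supported on types independent of the type `b` is controlled by the links of the
vertices of type `b`. -/
theorem edgeForm_le_of_indep (hτ : K.IsFace τ) {A : Finset (Fin (d + 1))} {b : Fin (d + 1)}
    (hbA : b ∉ A) (hb : b ∈ K.freeTypes τ)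
    (hind : ∀ x z, K.vtype x ∈ A → K.vtype z = b →
      K.edgeWeight τ z x * K.faceWeight τ = K.vertexWeight τ z * K.vertexWeight τ x)
    {h : Fin (d + 1) → ℝ} (h' : V → Fin (d + 1) → ℝ)
    (hbd : ∀ z, K.vtype z = b → K.vertexWeight τ z ≠ 0 → K.VarianceBound (insert z τ) (h' z))
    (hle : ∀ z, K.vtype z = b → ∀ a ∈ A, h' z a ≤ h a)
    (hf : K.MeanZero τ f) (hfA : ∀ x, K.vtype x ∉ A → f x = 0) :
    K.edgeForm τ f ≤ ∑ x, K.vertexWeight τ x * (h (K.vtype x) * f x ^ 2) := by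
  have hw := hτ.faceWeight_pos
  have hq : ∀ z, K.vtype z = b → ∀ x, K.edgeWeight τ z x * f x =
      K.vertexWeight τ z / K.faceWeight τ * (K.vertexWeight τ x * f x) := fun z hz x => by
    by_cases hx : K.vtype x ∈ A
    · rw [eq_div_of_mul_eq hw.ne' (hind x z hx hz)]; ring
    · rw [hfA x hx]; ring
  have h1 : K.edgeForm τ f = ∑ z with K.vtype z = b,
      (if z ∈ τ then 0 else K.edgeForm (insert z τ) f) := by
    have h1 : ∀ z, (if z ∈ τ then 0 else K.edgeForm (insert z τ) f) =
        ∑ x, ∑ y, (if z ∈ τ then 0 else K.edgeWeight (insert z τ) x y) * (f x * f y) := fun z => by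
      split_ifs <;> simp [edgeForm]
    simp only [h1]
    rw [Finset.sum_comm]
    refine Finset.sum_congr rfl fun x _ => ?_
    rw [Finset.sum_comm]
    refine Finset.sum_congr rfl fun y _ => ?_
    rw [← Finset.sum_mul, sum_edgeWeight_insert]
    by_cases hx : K.vtype x ∈ A
    · by_cases hy : K.vtype y ∈ A
      · rw [if_pos]
        exact Finset.mem_erase.2 ⟨fun h => hbA (h ▸ hy), Finset.mem_erase.2
          ⟨fun h => hbA (h ▸ hx), hb⟩⟩
      · rw [hfA y hy]; ring
    · rw [hfA x hx]; ring
  have h2 : ∀ z ∈ Finset.univ.filter (fun z => K.vtype z = b),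
      (if z ∈ τ then 0 else K.edgeForm (insert z τ) f) ≤ K.vertexWeight τ z *
        ((∑ x, K.vertexWeight τ x * (h (K.vtype x) * f x ^ 2)) / K.faceWeight τ) := by
    intro z hz
    have hzb := (Finset.mem_filter.1 hz).2
    have hzτ : z ∉ τ := notMem_of_vtype_mem_freeTypes (hzb ▸ hb)
    rw [if_neg hzτ]
    by_cases hp : K.vertexWeight τ z = 0
    · have h0 : ∀ x y, K.edgeWeight (insert z τ) x y = 0 := fun x y =>
        K.edgeWeight_eq_zero_of_vertexWeight (by
          rw [← K.edgeWeight_of_notMem hzτ]; exact K.edgeWeight_eq_zero_of_vertexWeight hp)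
      simp [edgeForm, h0, hp]
    · refine (hbd z hzb hp f fun i => ?_).trans ?_
      · simp only [← K.edgeWeight_of_notMem hzτ, hq z hzb]
        rw [← Finset.mul_sum, hf i, mul_zero]
      · rw [← mul_div_assoc, mul_div_right_comm, Finset.mul_sum]
        refine Finset.sum_le_sum fun x _ => ?_
        rw [← K.edgeWeight_of_notMem hzτ]
        by_cases hx : K.vtype x ∈ A
        · have e1 : K.vertexWeight τ z / K.faceWeight τ *
              (K.vertexWeight τ x * (h (K.vtype x) * f x ^ 2)) =
              K.edgeWeight τ z x * (h (K.vtype x) * f x ^ 2) := by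
            linear_combination -(h (K.vtype x) * f x) * hq z hzb x
          rw [e1]
          exact mul_le_mul_of_nonneg_left (mul_le_mul_of_nonneg_right (hle z hzb _ hx)
            (sq_nonneg _)) (K.edgeWeight_nonneg _ _ _)
        · simp [hfA x hx]
  rw [h1]
  refine (Finset.sum_le_sum h2).trans_eq ?_
  rw [← Finset.sum_mul, sum_vertexWeight, if_pos hb, mul_div_cancel₀ _ hw.ne']

/-- The bound for a link whose types split into two independent groups. -/
theorem varianceBound_of_indep (hτ : K.IsFace τ) {A B : Finset (Fin (d + 1))} (hAB : Disjoint A B)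
    (hS : K.freeTypes τ = A ∪ B) (hA : A.Nonempty) (hB : B.Nonempty)
    (hind : ∀ x y, K.vtype x ∈ A → K.vtype y ∈ B →
      K.edgeWeight τ x y * K.faceWeight τ = K.vertexWeight τ x * K.vertexWeight τ y)
    {h : Fin (d + 1) → ℝ} (h' : V → Fin (d + 1) → ℝ)
    (hbd : ∀ z, K.vertexWeight τ z ≠ 0 → K.VarianceBound (insert z τ) (h' z))
    (hleA : ∀ z, K.vtype z ∈ B → ∀ a ∈ A, h' z a ≤ h a)
    (hleB : ∀ z, K.vtype z ∈ A → ∀ a ∈ B, h' z a ≤ h a) : K.VarianceBound τ h := by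
  intro f hf
  have hw := hτ.faceWeight_pos
  obtain ⟨a, ha⟩ := hA
  obtain ⟨b, hb⟩ := hB
  set fA : V → ℝ := fun x => (if K.vtype x ∈ A then 1 else 0) * f x with hfA
  set fB : V → ℝ := fun x => (if K.vtype x ∈ B then 1 else 0) * f x with hfB
  have mA : K.MeanZero τ fA := hf.mul_vtype fun i => if i ∈ A then 1 else 0
  have mB : K.MeanZero τ fB := hf.mul_vtype fun i => if i ∈ B then 1 else 0
  have bA := K.edgeForm_le_of_indep hτ (Finset.disjoint_right.1 hAB hb)
    (hS ▸ Finset.mem_union_right _ hb)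
    (fun x z hx hz => by rw [K.edgeWeight_comm, hind x z hx (hz ▸ hb), mul_comm]) h'
    (fun z _ => hbd z) (fun z hz => hleA z (hz ▸ hb)) mA (fun x hx => by simp [hfA, hx])
  have bB := K.edgeForm_le_of_indep hτ (Finset.disjoint_left.1 hAB ha)
    (hS ▸ Finset.mem_union_left _ ha)
    (fun x z hx hz => hind z x (hz ▸ ha) hx) h'
    (fun z _ => hbd z) (fun z hz => hleB z (hz ▸ ha)) mB (fun x hx => by simp [hfB, hx])
  have hsplit : ∀ x, K.vertexWeight τ x ≠ 0 → f x = fA x + fB x := fun x hx => by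
    have := vtype_mem_of_vertexWeight_ne_zero hx
    rw [hS, Finset.mem_union] at this
    rcases this with h | h
    · simp [hfA, hfB, h, Finset.disjoint_left.1 hAB h]
    · simp [hfA, hfB, h, Finset.disjoint_right.1 hAB h]
  have hcross : ∑ x, ∑ y, K.edgeWeight τ x y * (fA x * fB y) = 0 := by
    have : ∀ x y, K.edgeWeight τ x y * (fA x * fB y) =
        K.vertexWeight τ x * fA x * (K.vertexWeight τ y * fB y) / K.faceWeight τ := fun x y => by
      by_cases hx : K.vtype x ∈ A
      · by_cases hy : K.vtype y ∈ B
        · rw [eq_div_of_mul_eq hw.ne' (hind x y hx hy)]; ring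
        · simp [hfB, hy]
      · simp [hfA, hx]
    simp only [this, ← Finset.sum_div, ← Finset.mul_sum, mB.sum_eq_zero, mul_zero,
      Finset.sum_const_zero, zero_div]
  have hcross' : ∑ x, ∑ y, K.edgeWeight τ x y * (fB x * fA y) = 0 := by
    rw [Finset.sum_comm, ← hcross]
    exact Finset.sum_congr rfl fun x _ => Finset.sum_congr rfl fun y _ => by
      rw [K.edgeWeight_comm]; ring
  have hform : K.edgeForm τ f = K.edgeForm τ fA + K.edgeForm τ fB := by
    rw [edgeForm_congr (g := fun x => fA x + fB x) hsplit]
    have : K.edgeForm τ (fun x => fA x + fB x) = K.edgeForm τ fA + K.edgeForm τ fB +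
        ∑ x, ∑ y, K.edgeWeight τ x y * (fA x * fB y) +
        ∑ x, ∑ y, K.edgeWeight τ x y * (fB x * fA y) := by
      simp only [edgeForm, ← Finset.sum_add_distrib]
      exact Finset.sum_congr rfl fun x _ => Finset.sum_congr rfl fun y _ => by ring
    rw [this, hcross, hcross', add_zero, add_zero]
  rw [hform]
  refine (add_le_add bA bB).trans_eq ?_
  rw [← Finset.sum_add_distrib]
  refine Finset.sum_congr rfl fun x _ => ?_
  by_cases hx : K.vertexWeight τ x = 0
  · simp [hx]
  · have h0 : fA x * fB x = 0 := by
      by_cases h : K.vtype x ∈ A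
      · simp [hfB, Finset.disjoint_left.1 hAB h]
      · simp [hfA, h]
    rw [hsplit x hx]
    linear_combination -2 * K.vertexWeight τ x * h (K.vtype x) * h0

/-- A crude uniform trickle-down step. -/
theorem varianceBound_half (hconn : K.TotallyConnected) (hτ : K.IsFace τ)
    (hk : 3 ≤ (K.freeTypes τ).card)
    (hb : ∀ z, K.vertexWeight τ z ≠ 0 →
      K.VarianceBound (insert z τ) fun _ => (((K.freeTypes τ).card : ℝ) - 2) / 5) :
    K.VarianceBound τ fun _ => (((K.freeTypes τ).card : ℝ) - 2) / 2 := by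
  refine K.varianceBound_of_eigenvalue_nonpos hτ fun f hf h0 μ hμ => ?_
  have hk' : (3 : ℝ) ≤ (K.freeTypes τ).card := by exact_mod_cast hk
  set k : ℝ := ((K.freeTypes τ).card : ℝ) with hkdef
  simp only [← add_mul] at hμ
  have hlt := K.eigenvalue_lt hconn hτ (by omega) hf h0 hμ
  rw [← hkdef] at hlt
  set ν : ℝ := (k - 2) / 2 + μ with hν
  have hn := K.sum_sq_pos hf h0
  set n := ∑ x, K.vertexWeight τ x * f x ^ 2 with hndef
  have hloc := K.localization (fun _ _ => (k - 2) / 5) hb f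
  have e1 : K.edgeForm τ f = ν * n := by
    rw [edgeForm_eq, hndef, Finset.mul_sum]
    exact Finset.sum_congr rfl fun x _ => by rw [hμ]; ring
  have e2 : ∑ z, ∑ x, K.edgeWeight τ z x * ((k - 2) / 5 * f x ^ 2) =
      (k - 2) / 5 * ((k - 1) * n) := by
    rw [Finset.sum_comm, hndef, Finset.mul_sum, Finset.mul_sum]
    refine Finset.sum_congr rfl fun x _ => ?_
    rw [← Finset.sum_mul]
    simp only [K.edgeWeight_comm τ _ x]
    rw [sum_edgeWeight_right]
    ring
  have e3 : ∑ z, K.vertexWeight τ z * (K.linkOp τ f z ^ 2 -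
        ∑ a ∈ K.freeTypes (insert z τ), (1 + (k - 2) / 5) * K.typeMean (insert z τ) f a ^ 2) ≤
      (1 - (1 + (k - 2) / 5) / (k - 1)) * ν ^ 2 * n := by
    rw [hndef, Finset.mul_sum]
    refine Finset.sum_le_sum fun z _ => ?_
    by_cases hp : K.vertexWeight τ z = 0
    · simp [hp]
    · obtain ⟨hz, -⟩ := isFace_insert_of_vertexWeight_ne_zero hp
      have hcs := sq_sum_le_card_mul_sum_sq (s := K.freeTypes (insert z τ))
        (f := K.typeMean (insert z τ) f)
      have hzS := vtype_mem_of_vertexWeight_ne_zero hp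
      rw [K.sum_typeMean_insert hz, freeTypes_insert, Finset.card_erase_of_mem hzS,
        Nat.cast_pred (by omega), ← hkdef, hμ] at hcs
      rw [freeTypes_insert, ← Finset.mul_sum, hμ]
      set m := ∑ a ∈ (K.freeTypes τ).erase (K.vtype z), K.typeMean (insert z τ) f a ^ 2
      have hm : (ν * f z) ^ 2 / (k - 1) ≤ m := by
        rw [div_le_iff₀ (by linarith)]; linarith
      have hm' := mul_le_mul_of_nonneg_left hm (show 0 ≤ 1 + (k - 2) / 5 by linarith)
      have : (1 - (1 + (k - 2) / 5) / (k - 1)) * ν ^ 2 * (K.vertexWeight τ z * f z ^ 2) =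
          K.vertexWeight τ z * ((ν * f z) ^ 2 - (1 + (k - 2) / 5) * ((ν * f z) ^ 2 / (k - 1))) := by
        ring
      rw [this]
      exact mul_le_mul_of_nonneg_left (by linarith) (K.vertexWeight_nonneg _ _)
  rw [e1] at hloc
  have hmain := hloc.trans (add_le_add e2.le e3)
  have hk1 : 0 < k - 1 := by linarith
  obtain ⟨t, ht⟩ : ∃ t, ν = t * (k - 1) := ⟨ν / (k - 1), by field_simp⟩
  have ht1 : t < 1 := by
    rw [ht] at hlt
    nlinarith
  rw [ht] at hmain
  have hfac : (k - 2) * (k - 1) * n * (5 * t) ≤ (k - 2) * (k - 1) * n * (1 + 4 * t ^ 2) := by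
    have : (1 - (1 + (k - 2) / 5) / (k - 1)) * (t * (k - 1)) ^ 2 * n =
        (k - 2) * (k - 1) * n * (4 * t ^ 2) / 5 := by
      field_simp
      ring
    rw [this] at hmain
    linarith
  have hpos : 0 < (k - 2) * (k - 1) * n := mul_pos (mul_pos (by linarith) hk1) hn
  have h5 := le_of_mul_le_mul_left hfac hpos
  have ht4 : t ≤ 1 / 4 := by
    by_contra! h
    nlinarith
  have : ν ≤ (k - 1) / 4 := by rw [ht]; nlinarith
  rw [hν] at this
  linarith

/-- The trickle-down step: type-dependent bounds on the links of the vertices give a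
type-dependent bound on the link of `τ`. -/
theorem varianceBound_step (hconn : K.TotallyConnected) (hτ : K.IsFace τ)
    (hk : 3 ≤ (K.freeTypes τ).card) {h : Fin (d + 1) → ℝ} (h' : Fin (d + 1) → Fin (d + 1) → ℝ)
    (hb : ∀ z, K.vertexWeight τ z ≠ 0 → K.VarianceBound (insert z τ) (h' (K.vtype z)))
    (h'_nonneg : ∀ b a, 0 ≤ h' b a)
    (h'_le : ∀ b ∈ K.freeTypes τ, ∀ a ∈ (K.freeTypes τ).erase b,
      h' b a ≤ (((K.freeTypes τ).card : ℝ) - 2) / 5)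
    (h_lt : ∀ a ∈ K.freeTypes τ, h a ≤ (((K.freeTypes τ).card : ℝ) - 2) / 3)
    (hsum : ∀ a ∈ K.freeTypes τ, ∑ b ∈ (K.freeTypes τ).erase a, h' b a ≤
      (((K.freeTypes τ).card : ℝ) - 2) * h a - h a ^ 2) :
    K.VarianceBound τ h := by
  have half := K.varianceBound_half hconn hτ hk fun z hz => (hb z hz).mono fun a ha => by
    rw [freeTypes_insert] at ha
    exact h'_le _ (vtype_mem_of_vertexWeight_ne_zero hz) a ha
  refine K.varianceBound_of_eigenvalue_nonpos hτ fun f hf h0 μ hμ => ?_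
  by_contra! hμ0
  have hk' : (3 : ℝ) ≤ (K.freeTypes τ).card := by exact_mod_cast hk
  set k : ℝ := ((K.freeTypes τ).card : ℝ) with hkdef
  have hn := K.sum_sq_pos hf h0
  have hloc := K.localization (fun z => h' (K.vtype z)) hb f
  have hhalf := half f hf.2
  have e0 : ∑ x, K.vertexWeight τ x * ((k - 2) / 2 * f x ^ 2) =
      (k - 2) / 2 * ∑ x, K.vertexWeight τ x * f x ^ 2 := by
    rw [Finset.mul_sum]; exact Finset.sum_congr rfl fun x _ => by ring
  rw [e0] at hhalf
  have e1 : K.edgeForm τ f = ∑ x, K.vertexWeight τ x * (h (K.vtype x) * f x ^ 2) +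
      μ * ∑ x, K.vertexWeight τ x * f x ^ 2 := by
    rw [edgeForm_eq, Finset.mul_sum, ← Finset.sum_add_distrib]
    exact Finset.sum_congr rfl fun x _ => by rw [hμ]; ring
  have e2 : ∑ z, ∑ x, K.edgeWeight τ z x * (h' (K.vtype z) (K.vtype x) * f x ^ 2) ≤
      (k - 2) * ∑ x, K.vertexWeight τ x * (h (K.vtype x) * f x ^ 2) -
        ∑ x, K.vertexWeight τ x * (h (K.vtype x) ^ 2 * f x ^ 2) := by
    rw [Finset.sum_comm, Finset.mul_sum, ← Finset.sum_sub_distrib]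
    refine Finset.sum_le_sum fun x _ => ?_
    have hx := K.sum_edgeWeight_mul τ x fun b => h' b (K.vtype x)
    have hx' : ∑ z, K.edgeWeight τ z x * (h' (K.vtype z) (K.vtype x) * f x ^ 2) =
        f x ^ 2 * ∑ z, K.edgeWeight τ x z * h' (K.vtype z) (K.vtype x) := by
      rw [Finset.mul_sum]
      exact Finset.sum_congr rfl fun z _ => by rw [K.edgeWeight_comm]; ring
    rw [hx', hx]
    by_cases hp : K.vertexWeight τ x = 0
    · simp [hp]
    · have := mul_le_mul_of_nonneg_left (hsum _ (vtype_mem_of_vertexWeight_ne_zero hp))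
        (mul_nonneg (K.vertexWeight_nonneg τ x) (sq_nonneg (f x)))
      linarith
  have e3 : ∑ z, K.vertexWeight τ z * (K.linkOp τ f z ^ 2 -
        ∑ a ∈ K.freeTypes (insert z τ), (1 + h' (K.vtype z) a) * K.typeMean (insert z τ) f a ^ 2) ≤
      ∑ x, K.vertexWeight τ x * (h (K.vtype x) ^ 2 * f x ^ 2) +
        2 * μ * ∑ x, K.vertexWeight τ x * (h (K.vtype x) * f x ^ 2) +
        μ ^ 2 * ∑ x, K.vertexWeight τ x * f x ^ 2 := by
    rw [Finset.mul_sum, Finset.mul_sum, ← Finset.sum_add_distrib, ← Finset.sum_add_distrib]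
    refine Finset.sum_le_sum fun z _ => ?_
    have hm : 0 ≤ ∑ a ∈ K.freeTypes (insert z τ),
        (1 + h' (K.vtype z) a) * K.typeMean (insert z τ) f a ^ 2 := Finset.sum_nonneg fun a _ =>
      mul_nonneg (by linarith [h'_nonneg (K.vtype z) a]) (sq_nonneg _)
    rw [hμ]
    linarith [mul_nonneg (K.vertexWeight_nonneg τ z) hm]
  have e4 : ∑ x, K.vertexWeight τ x * (h (K.vtype x) * f x ^ 2) ≤
      (k - 2) / 3 * ∑ x, K.vertexWeight τ x * f x ^ 2 := by
    rw [Finset.mul_sum]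
    refine Finset.sum_le_sum fun x _ => ?_
    by_cases hp : K.vertexWeight τ x = 0
    · simp [hp]
    · have := mul_le_mul_of_nonneg_left (h_lt _ (vtype_mem_of_vertexWeight_ne_zero hp))
        (mul_nonneg (K.vertexWeight_nonneg τ x) (sq_nonneg (f x)))
      linarith
  set n := ∑ x, K.vertexWeight τ x * f x ^ 2
  set X := ∑ x, K.vertexWeight τ x * (h (K.vtype x) * f x ^ 2)
  rw [e1] at hloc hhalf
  have hmul : μ * ((k - 2) * n) ≤ μ * (2 * X + μ * n) := by nlinarith
  have hle := le_of_mul_le_mul_left hmul hμ0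
  nlinarith [mul_pos (show 0 < k - 2 by linarith) hn]

/-- The type-dependent bound holds for every link. -/
theorem varianceBound_typeBound (hconn : K.TotallyConnected) {e g : ℕ → ℝ} {G : ℝ}
    (hbase : ∀ τ, K.IsFace τ → (K.freeTypes τ).card = 2 → lambda2 (K.walkMatrix τ) ≤ e 0)
    (he : ∀ n < K.DeltaMax, 0 ≤ e n ∧ e n ≤ g 1)
    (he' : ∀ n : ℕ, n + 1 < K.DeltaMax → (n + 1) * e n ≤ (n + 1) * e (n + 1) - e (n + 1) ^ 2)
    (hg : ∀ n, 1 ≤ n → n ≤ K.DeltaMax → 0 ≤ g n ∧ g n ≤ G)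
    (hg' : ∀ n : ℕ, 1 ≤ n → n + 1 ≤ K.DeltaMax →
      n * g n ≤ n * g (n + 1) - (n + 1) * g (n + 1) ^ 2)
    (hG0 : 0 ≤ G) (hG : G ≤ 2 / 15) (τ : Finset V) (hτ : K.IsFace τ)
    (hk : 2 ≤ (K.freeTypes τ).card) :
    K.VarianceBound τ (typeBound K.dependentTypes e g (K.freeTypes τ)) := by
  have hirr : ∀ i, i ∉ K.dependentTypes i := fun i => by simp [dependentTypes]
  have hsymm : ∀ i j, j ∈ K.dependentTypes i → i ∈ K.dependentTypes j :=
    fun i j => K.mem_dependentTypes_symm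
  have hzero : ∀ τ i j, K.IsFace τ → i ≠ j → K.freeTypes τ = {i, j} → j ∉ K.dependentTypes i →
      K.VarianceBound τ fun _ => 0 := fun τ i j hτ hij hS hj =>
    (K.varianceBound_lambda2 hconn hτ (by rw [hS, Finset.card_pair hij])).mono fun _ _ =>
      K.lambda2_nonpos_of_notMem hτ hij hS hj
  have hbound := typeBound_nonneg_le K.card_dependentTypes_le he hg
  have hcard : ∀ (S : Finset (Fin (d + 1))) a, a ∈ S →
      typeBound K.dependentTypes e g S a ≤ ((S.card : ℝ) - 1) * (2 / 15) := fun S a ha => by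
    have h1 : (K.dependentTypes a ∩ S).card + 1 ≤ S.card :=
      Finset.card_lt_card ⟨Finset.inter_subset_right, fun h =>
        hirr a (Finset.mem_inter.1 (h ha)).1⟩
    have h2 : ((K.dependentTypes a ∩ S).card : ℝ) ≤ S.card - 1 := by
      rw [le_sub_iff_add_le]; exact_mod_cast h1
    exact (hbound S a).2.trans (mul_le_mul h2 hG hG0 ((Nat.cast_nonneg _).trans h2))
  induction hn : (K.freeTypes τ).card using Nat.strong_induction_on generalizing τ with
  | _ n ih =>
  set S := K.freeTypes τ with hSdef
  rcases hk.eq_or_lt with h2 | h3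
  · obtain ⟨i, j, hij, hS⟩ := Finset.card_eq_two.1 h2.symm
    have hpair : ∀ i j, i ≠ j → S = {i, j} →
        lambda2 (K.walkMatrix τ) ≤ typeBound K.dependentTypes e g S i := by
      intro i j hij hS
      by_cases hj : j ∈ K.dependentTypes i
      · have hi' := hirr i
        have hj' := hirr j
        have hji := hsymm i j hj
        rw [typeBound_of_inter_eq_singleton (j := j) (by grind)]
        have : K.dependentTypes j ∩ S = {i} := by grind
        rw [this]
        exact hbase τ hτ h2.symm
      · rw [typeBound_of_inter_eq_empty (by have := hirr i; grind)]
        exact K.lambda2_nonpos_of_notMem hτ hij hS hj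
    refine (K.varianceBound_lambda2 hconn hτ h2.symm).mono fun a ha => ?_
    rw [← hSdef, hS, Finset.mem_insert, Finset.mem_singleton] at ha
    rcases ha with rfl | rfl
    · exact hpair a j hij hS
    · exact hpair a i hij.symm (hS.trans (Finset.pair_comm _ _))
  have hb : ∀ z, K.vertexWeight τ z ≠ 0 →
      K.VarianceBound (insert z τ) (typeBound K.dependentTypes e g (S.erase (K.vtype z))) := by
    intro z hz
    have hzS : K.vtype z ∈ S := vtype_mem_of_vertexWeight_ne_zero hz
    have hc := Finset.card_erase_of_mem hzS
    have := ih _ (by rw [freeTypes_insert, ← hSdef, hc]; omega) (insert z τ)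
      (isFace_insert_of_vertexWeight_ne_zero hz).2
      (by rw [freeTypes_insert, ← hSdef, hc]; omega) rfl
    rwa [freeTypes_insert] at this
  by_cases hiso : ∃ i ∈ S, ∃ j ∈ S, IsolatedPair K.dependentTypes S i j
  · obtain ⟨i, hi, j, hj, hNi, hNj⟩ := hiso
    have hij : i ≠ j := fun h => by
      have : j ∈ K.dependentTypes i ∩ S := hNi ▸ Finset.mem_singleton_self j
      exact hirr i (h ▸ (Finset.mem_inter.1 this).1)
    have hdisj : Disjoint ({i, j} : Finset (Fin (d + 1))) (S \ {i, j}) := Finset.disjoint_sdiff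
    have hsub : ({i, j} : Finset (Fin (d + 1))) ⊆ S := by grind
    have hunion : S = {i, j} ∪ (S \ {i, j}) := (Finset.union_sdiff_of_subset hsub).symm
    have hdep : ∀ a ∈ ({i, j} : Finset (Fin (d + 1))), ∀ b ∈ S \ {i, j},
        b ∉ K.dependentTypes a := by
      intro a ha b hb hab
      have : b ∈ K.dependentTypes a ∩ S := Finset.mem_inter.2 ⟨hab, (Finset.mem_sdiff.1 hb).1⟩
      rw [Finset.mem_insert, Finset.mem_singleton] at ha
      rcases ha with rfl | rfl
      · rw [hNi] at this; grind
      · rw [hNj] at this; grind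
    have hdep' : ∀ b ∈ S \ {i, j}, ∀ a ∈ ({i, j} : Finset (Fin (d + 1))),
        a ∉ K.dependentTypes b := fun b hb a ha h => hdep a ha b hb (hsymm _ _ h)
    have hcongr : ∀ A B : Finset (Fin (d + 1)), S = A ∪ B →
        (∀ a ∈ A, ∀ b ∈ B, b ∉ K.dependentTypes a) → ∀ b ∈ B, ∀ a ∈ A,
        typeBound K.dependentTypes e g (S.erase b) a ≤ typeBound K.dependentTypes e g S a := by
      intro A B hAB hdep b hb a ha
      refine (typeBound_congr (inter_erase_of_notMem (hdep a ha b hb)) fun c hc =>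
        inter_erase_of_notMem ?_).le
      rw [inter_erase_of_notMem (hdep a ha b hb), Finset.mem_inter, hAB, Finset.mem_union] at hc
      exact hdep c (hc.2.resolve_right fun h => hdep a ha c h hc.1) b hb
    refine K.varianceBound_of_indep hτ hdisj hunion ⟨i, by simp⟩ ?_
      (fun x y hx hy => K.edgeWeight_mul_faceWeight hconn _ hsymm hzero τ hτ _ _ hdisj hunion hdep
        hx hy) _ hb
      (fun z hz a ha => hcongr _ _ hunion hdep _ hz a ha)
      (fun z hz a ha => hcongr _ _ (hunion.trans (Finset.union_comm _ _)) hdep' _ hz a ha)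
    rw [← Finset.card_pos, Finset.card_sdiff_of_subset hsub, Finset.card_pair hij]
    omega
  · push Not at hiso
    have hkR : (3 : ℝ) ≤ S.card := by exact_mod_cast h3
    refine K.varianceBound_step hconn hτ h3
      (fun b => typeBound K.dependentTypes e g (S.erase b)) hb (fun b a => (hbound _ a).1)
      (fun b hb a ha => ?_) (fun a ha => (hcard S a ha).trans (by linarith)) fun a ha =>
        sum_typeBound_erase_le hsymm hirr K.card_dependentTypes_le he he' hg' ha (hiso a ha)
    have := hcard _ a ha
    rw [Finset.card_erase_of_mem (show b ∈ S from hb),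
      Nat.cast_pred (show 0 < S.card by omega)] at this
    linarith

/-- An eigenvector of the walk with positive nontrivial eigenvalue has mean zero on every part. -/
theorem mem_meanZeroSubmodule_of_eigenvector (hτ : K.IsFace τ) (hk : 2 ≤ (K.freeTypes τ).card)
    {μ : ℝ} (hμ0 : 0 < μ) (hμ1 : μ < 1)
    (hf : ∀ x, K.linkOp τ f x = (((K.freeTypes τ).card : ℝ) - 1) * μ * f x) :
    f ∈ K.meanZeroSubmodule τ := by
  have hw := hτ.faceWeight_pos
  have hk' : (2 : ℝ) ≤ (K.freeTypes τ).card := by exact_mod_cast hk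
  set k : ℝ := ((K.freeTypes τ).card : ℝ) with hkdef
  have hpos : 0 < (k - 1) * μ := mul_pos (by linarith) hμ0
  have hmean : ∀ i ∈ K.freeTypes τ, ((k - 1) * μ + 1) * K.typeMean τ f i =
      ∑ a ∈ K.freeTypes τ, K.typeMean τ f a := by
    intro i hi
    have h1 := K.sum_linkOp_vtype hτ f hi
    have h2 : ∑ x with K.vtype x = i, K.vertexWeight τ x * K.linkOp τ f x =
        (k - 1) * μ * (K.faceWeight τ * K.typeMean τ f i) := by
      rw [typeMean, mul_div_cancel₀ _ hw.ne', Finset.mul_sum]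
      exact Finset.sum_congr rfl fun x _ => by rw [hf]; ring
    have h3 : (k - 1) * μ * K.typeMean τ f i =
        ∑ a ∈ (K.freeTypes τ).erase i, K.typeMean τ f a := by
      refine mul_left_cancel₀ hw.ne' ?_
      rw [← h1, h2]; ring
    rw [← Finset.add_sum_erase _ _ hi, ← h3]; ring
  have hM : ∑ a ∈ K.freeTypes τ, K.typeMean τ f a = 0 := by
    have h1 := Finset.sum_congr rfl hmean
    rw [← Finset.mul_sum, Finset.sum_const, nsmul_eq_mul, ← hkdef] at h1
    have h2 : (k - 1) * (1 - μ) * ∑ a ∈ K.freeTypes τ, K.typeMean τ f a = 0 := by linarith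
    exact (mul_eq_zero.1 h2).resolve_left (mul_pos (by linarith) (by linarith)).ne'
  refine ⟨fun x hx => ?_, fun i => ?_⟩
  · have := hf x
    rw [linkOp_apply, hx, div_zero] at this
    exact (mul_eq_zero.1 this.symm).resolve_left hpos.ne'
  · by_cases hi : i ∈ K.freeTypes τ
    · have h1 := hmean i hi
      rw [hM] at h1
      have h2 := (mul_eq_zero.1 h1).resolve_left (by linarith)
      rw [typeMean, div_eq_zero_iff] at h2
      exact h2.resolve_right hw.ne'
    · exact K.sum_vtype_eq_zero hi f

theorem VarianceBound.lambda2_le {K : PartiteWeightedComplex V d} {c : ℝ} (hτ : K.IsFace τ)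
    (hk : 2 ≤ (K.freeTypes τ).card) (hb : K.VarianceBound τ fun _ => c) (hc : 0 ≤ c) :
    lambda2 (K.walkMatrix τ) ≤ c / ((K.freeTypes τ).card - 1) := by
  have hk' : (2 : ℝ) ≤ (K.freeTypes τ).card := by exact_mod_cast hk
  have hk1 : (0 : ℝ) < (K.freeTypes τ).card - 1 := by linarith
  refine Real.sSup_le (fun μ hμ => ?_) (div_nonneg hc hk1.le)
  rcases le_or_gt μ 0 with h0 | h0
  · exact h0.trans (div_nonneg hc hk1.le)
  obtain ⟨f, hf0, hf⟩ := Matrix.mem_spectrum_iff_exists_mulVec.1 hμ.2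
  have hH : ∀ x, K.linkOp τ f x = (((K.freeTypes τ).card : ℝ) - 1) * μ * f x := fun x => by
    have := congrFun hf x
    rw [K.walkMatrix_mulVec hτ, Pi.smul_apply, smul_eq_mul, div_eq_iff hk1.ne'] at this
    rw [this]; ring
  have hmem := K.mem_meanZeroSubmodule_of_eigenvector hτ hk h0 hμ.1 hH
  have h1 := hb f hmem.2
  have h2 : K.edgeForm τ f =
      (((K.freeTypes τ).card : ℝ) - 1) * μ * ∑ x, K.vertexWeight τ x * f x ^ 2 := by
    rw [edgeForm_eq, Finset.mul_sum]
    exact Finset.sum_congr rfl fun x _ => by rw [hH]; ring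
  have h3 : ∑ x, K.vertexWeight τ x * (c * f x ^ 2) =
      c * ∑ x, K.vertexWeight τ x * f x ^ 2 := by
    rw [Finset.mul_sum]; exact Finset.sum_congr rfl fun x _ => by ring
  rw [h2, h3] at h1
  rw [le_div_iff₀ hk1, mul_comm]
  exact le_of_mul_le_mul_right h1 (K.sum_sq_pos hmem hf0)

end PartiteWeightedComplex

open WeightedComplex PartiteWeightedComplex in
/-- Improved trickle down for partite complexes, in terms of `Δ`. -/
theorem trickle_down_partite_Delta
    {V : Type*} [Fintype V] [DecidableEq V] {d : ℕ}
    (K : PartiteWeightedComplex V d)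
    (hconn : K.toWeightedComplex.TotallyConnected)
    (hΔ : 1 ≤ K.DeltaMax)
    (δ : ℝ) (hδ0 : 0 < δ) (hδ1 : δ < 1)
    (hγ2a : ∀ τ : Finset V, K.toWeightedComplex.IsFace τ → τ.card = d - 1 →
      lambda2 (K.toWeightedComplex.walkMatrix τ) ≤
        δ ^ 2 / (10 * (1 + Real.log (K.DeltaMax : ℝ))))
    (hγ2b : ∀ τ : Finset V, K.toWeightedComplex.IsFace τ → τ.card = d - 1 →
      lambda2 (K.toWeightedComplex.walkMatrix τ) ≤
        (1 - δ) / ((K.DeltaMax : ℝ) + Real.log (K.DeltaMax : ℝ))) :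
    ∀ k : ℕ, 3 ≤ k → k ≤ d + 1 →
      ∀ τ : Finset V, K.toWeightedComplex.IsFace τ → τ.card = d + 1 - k →
        (K.DeltaMax ≤ k →
          lambda2 (K.toWeightedComplex.walkMatrix τ) ≤ 2 * (1 - δ) / ((k : ℝ) * δ)) ∧
        (k < K.DeltaMax →
          lambda2 (K.toWeightedComplex.walkMatrix τ) ≤
            2 * (1 - δ) * ((k : ℝ) + Real.log (k : ℝ)) /
              (((K.DeltaMax : ℝ) + Real.log (K.DeltaMax : ℝ)) * ((k : ℝ) * δ))) := by
  classical
  have hΔR : (1 : ℝ) ≤ K.DeltaMax := by exact_mod_cast hΔ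
  have hlog : 0 ≤ Real.log K.DeltaMax := Real.log_natCast_nonneg _
  set ε := min (δ ^ 2 / (10 * (1 + Real.log (K.DeltaMax : ℝ))))
    ((1 - δ) / ((K.DeltaMax : ℝ) + Real.log (K.DeltaMax : ℝ)))
  have hε : 0 < ε := lt_min (by positivity) (div_pos (by linarith) (by linarith))
  have h1 : ε * (10 * (1 + Real.log K.DeltaMax)) ≤ δ ^ 2 :=
    (le_div_iff₀ (by positivity)).1 (min_le_left _ _)
  have h2 : ε * (K.DeltaMax + Real.log K.DeltaMax) ≤ 1 - δ :=
    (le_div_iff₀ (by linarith)).1 (min_le_right _ _)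
  obtain ⟨e, g, he0, he, he', hg', hg⟩ := exists_growth_profile hΔ hδ0 hδ1 hε h1 h2
  have hG0 : 0 ≤ 4 / 3 * (ε / δ) := by positivity
  have hG : 4 / 3 * (ε / δ) ≤ 2 / 15 := by
    have : ε / δ ≤ 1 / 10 := by
      rw [div_le_iff₀ hδ0]
      nlinarith [mul_nonneg hε.le hlog]
    linarith
  intro k hk hkd τ hτ hτk
  have hcard : (K.freeTypes τ).card = k := by
    have := IsFace.card_freeTypes hτ
    omega
  have hkR : (3 : ℝ) ≤ k := by exact_mod_cast hk
  have hbound := K.varianceBound_typeBound hconn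
    (fun σ hσ hσ2 => by
      have hσd : σ.card = d - 1 := by
        have := IsFace.card_freeTypes hσ
        omega
      rw [he0]
      exact le_min (hγ2a σ hσ hσd) (hγ2b σ hσ hσd))
    he he' hg hg' hG0 hG τ hτ (by omega)
  have hle : ∀ m : ℕ, (∀ a ∈ K.freeTypes τ, (K.dependentTypes a ∩ K.freeTypes τ).card ≤ m) →
      lambda2 (K.toWeightedComplex.walkMatrix τ) ≤ m * (4 / 3 * (ε / δ)) / (k - 1) := by
    intro m hm
    rw [← hcard]
    refine VarianceBound.lambda2_le hτ (by omega) (hbound.mono fun a ha => ?_) (by positivity)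
    refine (typeBound_nonneg_le K.card_dependentTypes_le he hg _ a).2.trans ?_
    gcongr
    exact hm a ha
  constructor
  · intro _
    refine (hle K.DeltaMax fun a _ =>
      (Finset.card_le_card Finset.inter_subset_left).trans (K.card_dependentTypes_le a)).trans ?_
    have h3 : ε * K.DeltaMax ≤ 1 - δ := by nlinarith [mul_nonneg hε.le hlog]
    rw [show K.DeltaMax * (4 / 3 * (ε / δ)) / ((k : ℝ) - 1) =
      4 / 3 * (ε * K.DeltaMax) / (((k : ℝ) - 1) * δ) by field_simp,
      div_le_div_iff₀ (mul_pos (by linarith) hδ0) (by positivity)]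
    have h4 : ε * K.DeltaMax * (4 / 3 * k) ≤ (1 - δ) * (2 * (k - 1)) :=
      mul_le_mul h3 (by linarith) (by positivity) (by linarith)
    nlinarith [mul_le_mul_of_nonneg_right h4 hδ0.le]
  · intro _
    have h3 := hle (k - 1) fun a ha => by
      rw [← hcard, ← Finset.card_erase_of_mem ha]
      refine Finset.card_le_card fun b hb => Finset.mem_erase.2 ⟨?_, (Finset.mem_inter.1 hb).2⟩
      rintro rfl
      simp [dependentTypes] at hb
    rw [Nat.cast_pred (by omega), mul_div_cancel_left₀ _ (by linarith)] at h3
    refine h3.trans ?_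
    have hD : 0 < (K.DeltaMax : ℝ) + Real.log K.DeltaMax := by linarith
    have hlogk : 0 ≤ Real.log k := Real.log_natCast_nonneg _
    rw [show 4 / 3 * (ε / δ) = 4 / 3 * ε / δ by ring, div_le_div_iff₀ hδ0 (by positivity)]
    have h4 : ε * (K.DeltaMax + Real.log K.DeltaMax) * (4 / 3 * k) ≤
        (1 - δ) * (2 * (k + Real.log k)) :=
      mul_le_mul h2 (by linarith) (by positivity) (by linarith)
    nlinarith [mul_le_mul_of_nonneg_right h4 hδ0.le]
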